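/- arXiv:2512.01857 — 3 statements merged into one kernel-verified Lean document; each statement's English description precedes it below -/
import Mathlib

section
/- Let T be a finite tree such that: (a) there do not exist three nonempty sets A, B, C ⊆ V(T) with, for every X ∈ {A, B, C}, N_T[X] disjoint from both other sets, T[X] connected and not a path, and the two other sets in the same connected component of T − N_T[X]; and (b) there do not exist four pairwise disjoint sets A, B, C, D each inducing a claw in T, an A–B path P with V(P) disjoint from N_T[C ∪ D], a C–D path Q with V(Q) disjoint from N_T[A ∪ B], at most one edge between A ∪ B and C ∪ D, this edge (if it exists) joining a leaf of one of the claws A, B to a leaf of one of the claws C, D. Then T is an induced minor of T_{2,ℓ} or of T_{3,ℓ}, where ℓ = |V(T)|. -/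
open SimpleGraph

namespace Paper

variable {V W : Type*}

/-- `H` occurs as a subgraph of `G`: an injective map preserving adjacency. -/
def HasSubgraphCopy (G : SimpleGraph V) (H : SimpleGraph W) : Prop :=
  ∃ f : W → V, Function.Injective f ∧ ∀ u v, H.Adj u v → G.Adj (f u) (f v)

/-- The complete bipartite graph `K_{t,t}`. -/
def Ktt (t : ℕ) : SimpleGraph (Fin t ⊕ Fin t) := completeBipartiteGraph (Fin t) (Fin t)

/-- The claw `K_{1,3}`. -/
def clawGraph : SimpleGraph (Fin 1 ⊕ Fin 3) := completeBipartiteGraph (Fin 1) (Fin 3)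

/-- An induced minor model of `H` in `G`: pairwise disjoint nonempty connected branch
sets such that there is an edge between two branch sets iff the corresponding vertices
of `H` are adjacent. -/
def IsInducedMinorModel (H : SimpleGraph W) (G : SimpleGraph V) (M : W → Set V) : Prop :=
  (∀ v, (M v).Nonempty) ∧
  (∀ v, (G.induce (M v)).Connected) ∧
  (Pairwise fun u v => Disjoint (M u) (M v)) ∧
  (∀ u v, u ≠ v → ((∃ a ∈ M u, ∃ b ∈ M v, G.Adj a b) ↔ H.Adj u v))

/-- `H` is an induced minor of `G`. -/
def InducedMinor (H : SimpleGraph W) (G : SimpleGraph V) : Prop :=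
  ∃ M : W → Set V, IsInducedMinorModel H G M

/-- `G` admits a path-decomposition of width at most `w`. -/
def HasPWAtMost (G : SimpleGraph V) (w : ℕ) : Prop :=
  ∃ (m : ℕ) (B : Fin (m + 1) → Set V),
    (∀ v, ∃ i, v ∈ B i) ∧
    (∀ u v, G.Adj u v → ∃ i, u ∈ B i ∧ v ∈ B i) ∧
    (∀ v, ∀ i j k : Fin (m + 1), i ≤ j → j ≤ k → v ∈ B i → v ∈ B k → v ∈ B j) ∧
    (∀ i, (B i).ncard ≤ w + 1)

/-- The pathwidth of `G`. -/
noncomputable def pathwidth (G : SimpleGraph V) : ℕ := sInf {w | HasPWAtMost G w}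

/-- A class of (finite) graphs. -/
abbrev GraphClass := Set ((n : ℕ) × SimpleGraph (Fin n))

/-- A class of graphs is weakly sparse if it excludes some biclique `K_{t,t}` as a subgraph. -/
def WeaklySparseClass (𝒞 : GraphClass) : Prop :=
  ∃ t : ℕ, 1 ≤ t ∧ ∀ G ∈ 𝒞, ¬ HasSubgraphCopy G.2 (Ktt t)

/-- A class of graphs has bounded pathwidth. -/
def BddPathwidth (𝒞 : GraphClass) : Prop :=
  ∃ w : ℕ, ∀ G ∈ 𝒞, pathwidth G.2 ≤ w

/-- A graph `H` is positive if every weakly sparse class of graphs excluding `H` as an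
induced minor has bounded pathwidth. -/
def IsPositive (H : SimpleGraph W) : Prop :=
  ∀ 𝒞 : GraphClass, WeaklySparseClass 𝒞 → (∀ G ∈ 𝒞, ¬ InducedMinor H G.2) →
    BddPathwidth 𝒞

/-- A graph `H` is negative if some weakly sparse class of graphs excluding `H` as an
induced minor has unbounded pathwidth. -/
def IsNegative (H : SimpleGraph W) : Prop :=
  ∃ 𝒞 : GraphClass, WeaklySparseClass 𝒞 ∧ (∀ G ∈ 𝒞, ¬ InducedMinor H G.2) ∧
    ¬ BddPathwidth 𝒞

/-- The closed neighborhood of a set of vertices. -/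
def closedNbhd (G : SimpleGraph V) (S : Set V) : Set V :=
  {x | x ∈ S ∨ ∃ s ∈ S, G.Adj s x}

/-- The set `A` induces a claw in `G`. -/
def IsClawSet (G : SimpleGraph V) (A : Set V) : Prop :=
  Nonempty ((G.induce A) ≃g clawGraph)

/-- `v` is the center of the claw induced by `A`. -/
def IsClawCenter (G : SimpleGraph V) (A : Set V) (v : V) : Prop :=
  v ∈ A ∧ ∀ u ∈ A, u ≠ v → G.Adj v u

/-- `v` is a leaf of the claw induced by `A`. -/
def IsClawLeaf (G : SimpleGraph V) (A : Set V) (v : V) : Prop :=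
  v ∈ A ∧ ¬ IsClawCenter G A v

/-- `G` is (isomorphic to) a path graph. -/
def IsPathGraph (G : SimpleGraph V) : Prop :=
  ∃ n : ℕ, Nonempty (G ≃g pathGraph n)

/-- Any two vertices of `Y` and `Z` are joined by a walk avoiding `S`. -/
def SameComponentAvoiding (G : SimpleGraph V) (Y Z S : Set V) : Prop :=
  ∀ u ∈ Y, ∀ v ∈ Z, ∃ p : G.Walk u v, ∀ x ∈ p.support, x ∉ S

/-- Some vertex of `Y` is joined to some vertex of `Z` by a walk avoiding `S`. -/
def ConnectsAvoiding (G : SimpleGraph V) (Y Z S : Set V) : Prop :=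
  ∃ u ∈ Y, ∃ v ∈ Z, ∃ p : G.Walk u v, ∀ x ∈ p.support, x ∉ S

/-- There is an `A`–`B` path all of whose vertices avoid `S`. -/
def PathBetweenAvoiding (G : SimpleGraph V) (A B S : Set V) : Prop :=
  ∃ a ∈ A, ∃ b ∈ B, ∃ p : G.Walk a b, p.IsPath ∧ ∀ x ∈ p.support, x ∉ S

/-- `a`, `b`, `c` form an asteroidal triple in `G`. -/
def AsteroidalTriple (G : SimpleGraph V) (a b c : V) : Prop :=
  a ≠ b ∧ a ≠ c ∧ b ≠ c ∧ ¬ G.Adj a b ∧ ¬ G.Adj a c ∧ ¬ G.Adj b c ∧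
  ConnectsAvoiding G {a} {b} (closedNbhd G {c}) ∧
  ConnectsAvoiding G {a} {c} (closedNbhd G {b}) ∧
  ConnectsAvoiding G {b} {c} (closedNbhd G {a})

/-- Selector for three sets. -/
def pick3 (A B C : Set V) : Fin 3 → Set V :=
  fun i => if i = 0 then A else if i = 1 then B else C

/-- The graph obtained from `G` by contracting each of the three disjoint sets
`A`, `B`, `C` into a single vertex. -/
def contractThree (G : SimpleGraph V) (A B C : Set V) :
    SimpleGraph ({x : V // x ∉ A ∪ B ∪ C} ⊕ Fin 3) :=
  SimpleGraph.fromRel (fun a b =>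
    match a, b with
    | Sum.inl x, Sum.inl y => G.Adj x.1 y.1
    | Sum.inl x, Sum.inr i => ∃ s ∈ pick3 A B C i, G.Adj x.1 s
    | Sum.inr i, Sum.inr j => ∃ s ∈ pick3 A B C i, ∃ t ∈ pick3 A B C j, G.Adj s t
    | Sum.inr _, Sum.inl _ => False)

/-- Three pairwise disjoint claws whose contraction into single vertices `a`, `b`, `c`
yields a forest in which `a`, `b`, `c` form an asteroidal triple. -/
def ThreeClawsConfig (F : SimpleGraph V) : Prop :=
  ∃ A B C : Set V, IsClawSet F A ∧ IsClawSet F B ∧ IsClawSet F C ∧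
    Disjoint A B ∧ Disjoint A C ∧ Disjoint B C ∧
    (contractThree F A B C).IsAcyclic ∧
    AsteroidalTriple (contractThree F A B C) (Sum.inr 0) (Sum.inr 1) (Sum.inr 2)

/-- There is at most one edge of `G` between `S` and `T`. -/
def AtMostOneCrossEdge (G : SimpleGraph V) (S T : Set V) : Prop :=
  ∀ x ∈ S, ∀ y ∈ T, G.Adj x y → ∀ x' ∈ S, ∀ y' ∈ T, G.Adj x' y' → x = x' ∧ y = y'

/-- Four pairwise disjoint claws `A`, `B`, `C`, `D`, an `A`–`B` path avoiding `N[C ∪ D]`,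
a `C`–`D` path avoiding `N[A ∪ B]`, and at most one edge between `A ∪ B` and `C ∪ D`. -/
def FourClawsCore (H : SimpleGraph V) (A B C D : Set V) : Prop :=
  IsClawSet H A ∧ IsClawSet H B ∧ IsClawSet H C ∧ IsClawSet H D ∧
  Disjoint A B ∧ Disjoint A C ∧ Disjoint A D ∧
  Disjoint B C ∧ Disjoint B D ∧ Disjoint C D ∧
  PathBetweenAvoiding H A B (closedNbhd H (C ∪ D)) ∧
  PathBetweenAvoiding H C D (closedNbhd H (A ∪ B)) ∧
  AtMostOneCrossEdge H (A ∪ B) (C ∪ D)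

/-- Four-claw configuration in which the possible edge between `A ∪ B` and `C ∪ D` joins
a leaf of one of the claws `A`, `B` to a leaf of one of the claws `C`, `D`. -/
def NdsConfig (H : SimpleGraph V) (A B C D : Set V) : Prop :=
  FourClawsCore H A B C D ∧
  ∀ x ∈ A ∪ B, ∀ y ∈ C ∪ D, H.Adj x y →
    (IsClawLeaf H A x ∨ IsClawLeaf H B x) ∧ (IsClawLeaf H C y ∨ IsClawLeaf H D y)

/-- Four-claw configuration in which the possible edge between `A ∪ B` and `C ∪ D` is not
incident to any of the four claw centers. -/
def NdsConfigCenters (H : SimpleGraph V) (A B C D : Set V) : Prop :=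
  FourClawsCore H A B C D ∧
  ∀ x ∈ A ∪ B, ∀ y ∈ C ∪ D, H.Adj x y → ∀ c : V,
    (IsClawCenter H A c ∨ IsClawCenter H B c ∨ IsClawCenter H C c ∨ IsClawCenter H D c) →
    x ≠ c ∧ y ≠ c

/-- Configuration of three sets as in the Pohoata–Davies grid lemma. -/
def NpdConfig (H : SimpleGraph V) (A B C : Set V) : Prop :=
  A.Nonempty ∧ B.Nonempty ∧ C.Nonempty ∧
  ∀ i : Fin 3,
    (∀ j : Fin 3, j ≠ i → Disjoint (closedNbhd H (pick3 A B C i)) (pick3 A B C j)) ∧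
    (H.induce (pick3 A B C i)).Connected ∧
    ¬ IsPathGraph (H.induce (pick3 A B C i)) ∧
    ∀ j k : Fin 3, j ≠ i → k ≠ i →
      SameComponentAvoiding H (pick3 A B C j) (pick3 A B C k)
        (closedNbhd H (pick3 A B C i))

/-- The `n × n` Pohoata–Davies grid: `n` paths on `n` vertices each (vertex `(j, i)` is
the `i`-th vertex of the `j`-th path), together with, for each `i`, a star vertex
adjacent to the `i`-th vertex of each path. -/
def pdGrid (n : ℕ) : SimpleGraph (Fin n × Fin n ⊕ Fin n) :=
  SimpleGraph.fromRel (fun a b =>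
    match a, b with
    | Sum.inl p, Sum.inl q => p.1 = q.1 ∧ (p.2 : ℕ) + 1 = (q.2 : ℕ)
    | Sum.inl p, Sum.inr s => p.2 = s
    | _, _ => False)

/-- The death star of height `n`: its path has `2^n - 1` vertices, and the star vertex
added at height `k+1` (for `k : Fin n`) is adjacent exactly to the path vertices `i`
with `i ≡ 2^(n-1-k) - 1 (mod 2^(n-k))`. -/
def deathStar (n : ℕ) : SimpleGraph (Fin (2 ^ n - 1) ⊕ Fin n) :=
  SimpleGraph.fromRel (fun a b =>
    match a, b with
    | Sum.inl i, Sum.inl j => (i : ℕ) + 1 = (j : ℕ)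
    | Sum.inl i, Sum.inr k => (i : ℕ) % 2 ^ (n - (k : ℕ)) = 2 ^ (n - 1 - (k : ℕ)) - 1
    | _, _ => False)

/-- The tree `T_{1,ℓ}`: a root adjacent to the central vertex of each of `ℓ` disjoint
paths on `2ℓ + 1` vertices. -/
def T1Graph (ℓ : ℕ) : SimpleGraph (Unit ⊕ Fin ℓ × Fin (2 * ℓ + 1)) :=
  SimpleGraph.fromRel (fun a b =>
    match a, b with
    | Sum.inl _, Sum.inr p => (p.2 : ℕ) = ℓ
    | Sum.inr p, Sum.inr q => p.1 = q.1 ∧ (p.2 : ℕ) + 1 = (q.2 : ℕ)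
    | _, _ => False)

/-- Vertices of `T_{2,ℓ}` and `T_{3,ℓ}`: the root; the `ℓ` original leaves adjacent to
the root; the two subdivided paths `x_0, …, x_{ℓ+1}` and `y_0, …, y_{ℓ+1}` (with
`x = x_0`, `y = y_0` the non-leaf children of the root); three attached `ℓ`-edge paths;
and `ℓ + 3` glued copies of `T_{1,ℓ}` (each consisting of `ℓ` paths on `2ℓ+1` vertices,
the root of the copy being identified with the glue site). -/
abbrev TVert (ℓ : ℕ) : Type :=
  Unit ⊕ Fin ℓ ⊕ (Fin 2 × Fin (ℓ + 2)) ⊕ (Fin 3 × Fin ℓ) ⊕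
    (Fin (ℓ + 3) × Fin ℓ × Fin (2 * ℓ + 1))

/-- The `ℓ + 3` glue sites of a copy of `T_{1,ℓ}`: site `0` is `x`; site `1` is the far
end `x_{ℓ+1}`; site `2` is the far end `y_{ℓ+1}`; sites `3, …, ℓ+2` are the `ℓ` original
leaves adjacent to the root. -/
def glueSite (ℓ : ℕ) (k : Fin (ℓ + 3)) : TVert ℓ :=
  if h : 3 ≤ (k : ℕ) then Sum.inr (Sum.inl ⟨(k : ℕ) - 3, by have := k.isLt; omega⟩)
  else if (k : ℕ) = 0 then Sum.inr (Sum.inr (Sum.inl (0, ⟨0, by omega⟩)))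
  else if (k : ℕ) = 1 then Sum.inr (Sum.inr (Sum.inl (0, ⟨ℓ + 1, by omega⟩)))
  else Sum.inr (Sum.inr (Sum.inl (1, ⟨ℓ + 1, by omega⟩)))

/-- Attachment points of the three `ℓ`-edge paths: for both trees, paths `0` and `1` are
attached at `x_ℓ` and `y_ℓ` (the parents of the two original leaves non-adjacent to the
root); path `2` is attached at the child `x_1` of `x` for `T_{2,ℓ}` (`three = false`)
and at `y = y_0` for `T_{3,ℓ}` (`three = true`). -/
def attachPt (ℓ : ℕ) (three : Bool) (p : Fin 3) : TVert ℓ :=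
  if (p : ℕ) = 0 then Sum.inr (Sum.inr (Sum.inl (0, ⟨ℓ, by omega⟩)))
  else if (p : ℕ) = 1 then Sum.inr (Sum.inr (Sum.inl (1, ⟨ℓ, by omega⟩)))
  else if three then Sum.inr (Sum.inr (Sum.inl (1, ⟨0, by omega⟩)))
  else Sum.inr (Sum.inr (Sum.inl (0, ⟨1, by omega⟩)))

/-- Base adjacency of `T_{2,ℓ}` (`three = false`) and `T_{3,ℓ}` (`three = true`). -/
def TAdj (ℓ : ℕ) (three : Bool) : TVert ℓ → TVert ℓ → Prop := fun a b =>
  match a, b with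
  | Sum.inl _, Sum.inr (Sum.inl _) => True
  | Sum.inl _, Sum.inr (Sum.inr (Sum.inl p)) => (p.2 : ℕ) = 0
  | Sum.inr (Sum.inr (Sum.inl p)), Sum.inr (Sum.inr (Sum.inl q)) =>
      p.1 = q.1 ∧ (p.2 : ℕ) + 1 = (q.2 : ℕ)
  | Sum.inr (Sum.inr (Sum.inr (Sum.inl p))), Sum.inr (Sum.inr (Sum.inr (Sum.inl q))) =>
      p.1 = q.1 ∧ (p.2 : ℕ) + 1 = (q.2 : ℕ)
  | Sum.inr (Sum.inr (Sum.inr (Sum.inr p))), Sum.inr (Sum.inr (Sum.inr (Sum.inr q))) =>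
      p.1 = q.1 ∧ p.2.1 = q.2.1 ∧ (p.2.2 : ℕ) + 1 = (q.2.2 : ℕ)
  | x, Sum.inr (Sum.inr (Sum.inr (Sum.inl p))) => (p.2 : ℕ) = 0 ∧ x = attachPt ℓ three p.1
  | x, Sum.inr (Sum.inr (Sum.inr (Sum.inr p))) => (p.2.2 : ℕ) = ℓ ∧ x = glueSite ℓ p.1
  | _, _ => False

/-- The tree `T_{2,ℓ}`. -/
def T2Graph (ℓ : ℕ) : SimpleGraph (TVert ℓ) := SimpleGraph.fromRel (TAdj ℓ false)

/-- The tree `T_{3,ℓ}`. -/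
def T3Graph (ℓ : ℕ) : SimpleGraph (TVert ℓ) := SimpleGraph.fromRel (TAdj ℓ true)

/-- Disjoint union of two graphs. -/
def disjUnion (G : SimpleGraph V) (H : SimpleGraph W) : SimpleGraph (V ⊕ W) :=
  SimpleGraph.fromRel (fun a b =>
    match a, b with
    | Sum.inl x, Sum.inl y => G.Adj x y
    | Sum.inr x, Sum.inr y => H.Adj x y
    | _, _ => False)

/-- Disjoint union of `m` copies of `G`. -/
def copies (m : ℕ) (G : SimpleGraph V) : SimpleGraph (Fin m × V) :=
  SimpleGraph.fromRel (fun a b => a.1 = b.1 ∧ G.Adj a.2 b.2)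

/-- `T_{2,ℓ} ∪ ℓ·T_{1,ℓ}`. -/
def T2Union (ℓ : ℕ) : SimpleGraph (TVert ℓ ⊕ Fin ℓ × (Unit ⊕ Fin ℓ × Fin (2 * ℓ + 1))) :=
  disjUnion (T2Graph ℓ) (copies ℓ (T1Graph ℓ))

/-- `T_{3,ℓ} ∪ ℓ·T_{1,ℓ}`. -/
def T3Union (ℓ : ℕ) : SimpleGraph (TVert ℓ ⊕ Fin ℓ × (Unit ⊕ Fin ℓ × Fin (2 * ℓ + 1))) :=
  disjUnion (T3Graph ℓ) (copies ℓ (T1Graph ℓ))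

/-- Vertices of the infinite tree `T₁`. -/
abbrev T1InfVert : Type := Unit ⊕ ℕ ⊕ (ℕ × Fin 2 × ℕ)

/-- The infinite tree `T₁`: the root has countably many children, each child of the root
has exactly two children, and below these every vertex has exactly one child. -/
def T1Inf : SimpleGraph T1InfVert :=
  SimpleGraph.fromRel (fun a b =>
    match a, b with
    | Sum.inl _, Sum.inr (Sum.inl _) => True
    | Sum.inr (Sum.inl i), Sum.inr (Sum.inr p) => i = p.1 ∧ p.2.2 = 0
    | Sum.inr (Sum.inr p), Sum.inr (Sum.inr q) =>
        p.1 = q.1 ∧ p.2.1 = q.2.1 ∧ p.2.2 + 1 = q.2.2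
    | _, _ => False)

/-- A (finite) tree belongs to `𝒯₁` iff it is isomorphic to a connected induced
subgraph of `T₁`. -/
def MemT1Class (T : SimpleGraph W) : Prop :=
  ∃ S : Set T1InfVert, (T1Inf.induce S).Connected ∧ Nonempty (T ≃g T1Inf.induce S)

/-- In a tree `T` rooted at `r`, `u` is a (not necessarily strict) ancestor of `v`. -/
def IsAncestor (T : SimpleGraph V) (r u v : V) : Prop :=
  ∃ p : T.Walk r v, p.IsPath ∧ u ∈ p.support

/-- The vertex set of the subtree of `T` (rooted at `r`) rooted at `x`. -/
def rootedSubtree (T : SimpleGraph V) (r x : V) : Set V := {v | IsAncestor T r x v}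

/-- The set of vertices `x` whose rooted subtree contains a claw while no subtree rooted
at a strict descendant of `x` contains a claw. -/
def clawMinimalSet (T : SimpleGraph V) (r : V) : Set V :=
  {x | (∃ A ⊆ rootedSubtree T r x, IsClawSet T A) ∧
    ∀ y, IsAncestor T r x y → y ≠ x → ¬ ∃ A ⊆ rootedSubtree T r y, IsClawSet T A}

/-- `z` is the least common ancestor of `x` and `y` in the tree `T` rooted at `r`. -/
def IsLCA (T : SimpleGraph V) (r x y z : V) : Prop :=
  IsAncestor T r z x ∧ IsAncestor T r z y ∧
    ∀ w, IsAncestor T r w x → IsAncestor T r w y → IsAncestor T r w z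

/-- The set of least common ancestors of distinct pairs of `X`. -/
def lcaSet (T : SimpleGraph V) (r : V) (X : Set V) : Set V :=
  {z | ∃ x ∈ X, ∃ y ∈ X, x ≠ y ∧ IsLCA T r x y z}

/-- `(G, S, L)` is a constellation: `S` is independent, the components of `G - S` are
exactly the paths of `L`, and every vertex of `S` has a neighbor on every path of `L`. -/
structure IsConstellation (G : SimpleGraph V) (S : Set V) (L : Set (Set V)) : Prop where
  indep : S.Pairwise fun x y => ¬ G.Adj x y
  pathsOffS : ∀ P ∈ L, Disjoint P S
  cover : ∀ v, v ∉ S → ∃ P ∈ L, v ∈ P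
  pathsDisj : L.Pairwise fun P Q => Disjoint P Q
  pathsNonempty : ∀ P ∈ L, P.Nonempty
  pathsArePaths : ∀ P ∈ L, IsPathGraph (G.induce P)
  pathsSep : ∀ P ∈ L, ∀ Q ∈ L, P ≠ Q → ∀ u ∈ P, ∀ v ∈ Q, ¬ G.Adj u v
  dominates : ∀ s ∈ S, ∀ P ∈ L, ∃ v ∈ P, G.Adj s v

/-- `(S, L)` has sizes `(s, p)`. -/
def IsSPConst (S : Set V) (L : Set (Set V)) (s p : ℕ) : Prop :=
  S.Finite ∧ S.ncard = s ∧ L.Finite ∧ L.ncard = p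

/-- A `C`-route: a nontrivial path whose endpoints are in `S` and whose internal
vertices avoid `S`. -/
def IsRoute (G : SimpleGraph V) (S : Set V) (x y : V) (p : G.Walk x y) : Prop :=
  x ∈ S ∧ y ∈ S ∧ p.IsPath ∧ 0 < p.length ∧
    ∀ v ∈ p.support, v ≠ x → v ≠ y → v ∉ S

/-- `d`-ample: no route with at most `d + 1` edges. -/
def IsAmple (G : SimpleGraph V) (S : Set V) (d : ℕ) : Prop :=
  ∀ (x y : V) (p : G.Walk x y), IsRoute G S x y p → d + 1 < p.length

/-- `e` is an endpoint of the path induced on `P`. -/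
def IsPathEndpoint (G : SimpleGraph V) (P : Set V) (e : V) : Prop :=
  e ∈ P ∧ {v | v ∈ P ∧ G.Adj e v}.ncard ≤ 1

/-- `d`-ample in the strengthened sense: additionally no vertex of `S` has a neighbor on
a path `P ∈ L` at distance (in `P`) less than `d` from an endpoint of `P`. -/
def IsAmpleStrong (G : SimpleGraph V) (S : Set V) (L : Set (Set V)) (d : ℕ) : Prop :=
  IsAmple G S d ∧
  ∀ s ∈ S, ∀ P ∈ L, ∀ (v : V) (hv : v ∈ P), G.Adj s v →
    ∀ (e : V) (he : e ∈ P), IsPathEndpoint G P e →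
      d ≤ (G.induce P).dist ⟨v, hv⟩ ⟨e, he⟩

/-- `r` is a strict total order on `S`. -/
def StrictTotalOrderOn (S : Set V) (r : V → V → Prop) : Prop :=
  (∀ x ∈ S, ¬ r x x) ∧
  (∀ x ∈ S, ∀ y ∈ S, ∀ z ∈ S, r x y → r y z → r x z) ∧
  (∀ x ∈ S, ∀ y ∈ S, x ≠ y → r x y ∨ r y x)

/-- Interrupted constellation: some total order on `S` such that for every `x ≺ y ≺ z`,
every route between `x` and `y` is adjacent to `z`. -/
def IsInterrupted (G : SimpleGraph V) (S : Set V) : Prop :=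
  ∃ r : V → V → Prop, StrictTotalOrderOn S r ∧
    ∀ x ∈ S, ∀ y ∈ S, ∀ z ∈ S, r x y → r y z →
      ∀ p : G.Walk x y, IsRoute G S x y p → ∃ v ∈ p.support, G.Adj z v

/-- `q`-zigzagged constellation: some total order on `S` such that for every route
between `x` and `y`, fewer than `q` vertices strictly between `x` and `y` have no
neighbor on the route. -/
def IsZigzagged (G : SimpleGraph V) (S : Set V) (q : ℕ) : Prop :=
  ∃ r : V → V → Prop, StrictTotalOrderOn S r ∧
    ∀ x ∈ S, ∀ y ∈ S, ∀ p : G.Walk x y, IsRoute G S x y p →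
      {z | z ∈ S ∧ ((r x z ∧ r z y) ∨ (r y z ∧ r z x)) ∧
        ∀ v ∈ p.support, ¬ G.Adj z v}.ncard < q

/-- Lift a subset of `V` to a subset of the subtype `↥U`. -/
def liftToSub (U : Set V) (T : Set V) : Set ↥U := {v : ↥U | (v : V) ∈ T}

/-- The graph `H'` obtained from `H` by adding a disjoint path on `2ℓ+1` vertices and
joining `u` to the center of this path. -/
def addPendantPath (H : SimpleGraph W) (u : W) (ℓ : ℕ) :
    SimpleGraph (W ⊕ Fin (2 * ℓ + 1)) :=
  SimpleGraph.fromRel (fun a b =>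
    match a, b with
    | Sum.inl v, Sum.inl w => H.Adj v w
    | Sum.inl v, Sum.inr i => v = u ∧ (i : ℕ) = ℓ
    | Sum.inr i, Sum.inr j => (i : ℕ) + 1 = (j : ℕ)
    | Sum.inr _, Sum.inl _ => False)

/-- branch of `v` seen from `u` -/
def Br {V : Type*} (T : SimpleGraph V) (u v : V) : Set V :=
  {w | ∃ p : T.Walk v w, u ∉ p.support}

section branches
variable {V : Type*} {T : SimpleGraph V}

theorem Br_self {u v : V} (h : u ≠ v) : v ∈ Br T u v := ⟨Walk.nil, by simpa using h⟩

theorem Br_not {u v : V} : u ∉ Br T u v := fun ⟨p, hp⟩ => hp p.end_mem_support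

theorem Br_step {u v a b : V} (ha : a ∈ Br T u v) (hab : T.Adj a b) (hb : b ≠ u) :
    b ∈ Br T u v := by
  obtain ⟨p, hp⟩ := ha
  refine ⟨p.concat hab, ?_⟩
  rw [Walk.support_concat]
  simp only [List.mem_append, List.mem_singleton, not_or]
  exact ⟨hp, fun h => hb h.symm⟩

theorem Br_walk {u v w : V} (p : T.Walk v w) (hp : u ∉ p.support) :
    ∀ x ∈ p.support, x ∈ Br T u v := by
  classical
  intro x hx
  exact ⟨p.takeUntil x hx, fun h => hp (p.support_takeUntil_subset_support hx h)⟩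

theorem Br_joins {u v a b : V} (ha : a ∈ Br T u v) (hb : b ∈ Br T u v) :
    ∃ p : T.Walk a b, ∀ x ∈ p.support, x ∈ Br T u v := by
  obtain ⟨p, hp⟩ := ha
  obtain ⟨q, hq⟩ := hb
  refine ⟨p.reverse.append q, ?_⟩
  intro x hx
  rw [Walk.mem_support_append_iff] at hx
  rcases hx with hx | hx
  · exact Br_walk p hp x (by simpa using hx)
  · exact Br_walk q hq x hx

theorem Br_key (hT : T.IsTree) {v k u : V} (hk : T.Adj v k) (hu : T.Adj v u) (hne : k ≠ u) :
    u ∉ Br T v k := by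
  classical
  rintro ⟨p, hp⟩
  have hq : (Walk.cons hk.symm (Walk.cons hu Walk.nil)).IsPath := by
    simp [Walk.cons_isPath_iff, hk.ne', hu.ne, hne]
  have := hT.existsUnique_path k u |>.unique p.bypass_isPath hq
  have h2 : v ∈ p.bypass.support := by rw [this]; simp
  exact hp (p.support_bypass_subset_support h2)

theorem Br_disj (hT : T.IsTree) {v k u w : V} (hk : T.Adj v k) (hu : T.Adj v u) (hne : k ≠ u)
    (h1 : w ∈ Br T v k) (h2 : w ∈ Br T v u) : False := by
  obtain ⟨q, hq⟩ := h2
  obtain ⟨p, hp⟩ := Br_joins (Br_self hk.ne) h1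
  refine Br_key hT hk hu hne ⟨p.append q.reverse, ?_⟩
  rw [Walk.mem_support_append_iff]
  rintro (h | h)
  · exact Br_not (hp _ h)
  · exact hq (by simpa using h)

theorem Br_sub (hT : T.IsTree) {u v k : V} (hu : T.Adj u v) (hk : T.Adj v k) (hne : k ≠ u) :
    Br T v k ⊆ Br T u v := by
  rintro w ⟨p, hp⟩
  refine ⟨Walk.cons hk p, ?_⟩
  rw [Walk.support_cons, List.mem_cons, not_or]
  exact ⟨hu.ne, fun h => Br_key hT hk hu.symm hne (Br_walk p hp u h)⟩

theorem Br_cover (hT : T.IsTree) {v w : V} (h : w ≠ v) : ∃ k, T.Adj v k ∧ w ∈ Br T v k := by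
  classical
  obtain ⟨p, hp, -⟩ := hT.existsUnique_path v w
  cases p with
  | nil => exact absurd rfl h
  | cons ha q =>
    rw [Walk.cons_isPath_iff] at hp
    exact ⟨_, ha, q, hp.2⟩

theorem Br_cases (hT : T.IsTree) {u v w : V} (hu : T.Adj u v) (hw : w ∈ Br T u v) :
    w = v ∨ ∃ k, T.Adj v k ∧ k ≠ u ∧ w ∈ Br T v k := by
  classical
  by_cases h : w = v
  · exact Or.inl h
  obtain ⟨k, hk, hwk⟩ := Br_cover hT h
  refine Or.inr ⟨k, hk, ?_, hwk⟩
  rintro rfl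
  obtain ⟨p, hp⟩ := Br_joins (Br_self hk.ne) hwk
  obtain ⟨q, hq⟩ := Br_joins (Br_self hu.ne) hw
  obtain ⟨q', hq'⟩ := hw
  obtain ⟨p', hp'⟩ := hwk
  have hpath := p'.bypass_isPath
  have hqath := q'.bypass_isPath
  have : (Walk.cons hk p'.bypass).IsPath := by
    rw [Walk.cons_isPath_iff]
    exact ⟨hpath, fun h => hp' (p'.support_bypass_subset_support h)⟩
  have e := hT.existsUnique_path v w |>.unique this hqath
  apply hq'
  apply q'.support_bypass_subset_support
  rw [← e]; simp

/-- for an edge `uv` the only edge between both sides is `uv` -/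
theorem Br_edge {u v a b : V} (ha : a ∈ Br T u v) (hb : b ∉ Br T u v)
    (hab : T.Adj a b) : b = u := by
  by_contra h
  exact hb (Br_step ha hab h)

theorem Br_root (hT : T.IsTree) {u v a : V} (huv : T.Adj u v) (ha : a ∈ Br T u v)
    (hab : T.Adj a u) : a = v := by
  by_contra h
  exact Br_key hT huv hab.symm (Ne.symm h) ha

theorem Br_opp (hT : T.IsTree) {u v w : V} (huv : T.Adj u v) :
    w ∈ Br T v u ↔ w ∉ Br T u v := by
  constructor
  · intro h1 h2
    rcases Br_cases hT huv h2 with rfl | ⟨k, hk, hku, hw⟩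
    · exact Br_not h1
    · exact Br_disj hT hk huv.symm hku hw h1
  · intro h
    by_cases hw : w = v
    · subst hw; exact absurd (Br_self huv.ne) h
    obtain ⟨k, hk, hwk⟩ := Br_cover hT hw
    by_cases hku : k = u
    · subst hku; exact hwk
    · exact absurd (Br_sub hT huv hk hku hwk) h

theorem Br_root' (hT : T.IsTree) {u v a b : V} (huv : T.Adj u v) (ha : a ∈ Br T v u)
    (hb : b ∈ Br T u v) (hab : T.Adj a b) : a = u ∧ b = v := by
  have h1 : a = u := Br_edge hb ((Br_opp hT huv).1 ha) hab.symm
  subst h1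
  exact ⟨rfl, Br_root hT huv hb hab.symm⟩

/-- `v` together with the branches towards `K` -/
def KS {V : Type*} (T : SimpleGraph V) (v : V) (K : Set V) : Set V :=
  {w | w = v ∨ ∃ k ∈ K, w ∈ Br T v k}

/-- children of `v` seen from `u` -/
def Kd {V : Type*} (T : SimpleGraph V) (u v : V) : Set V := {k | T.Adj v k ∧ k ≠ u}

theorem KS_Kd (hT : T.IsTree) {u v : V} (huv : T.Adj u v) : KS T v (Kd T u v) = Br T u v := by
  ext w
  constructor
  · rintro (rfl | ⟨k, hk, hw⟩)
    · exact Br_self huv.ne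
    · exact Br_sub hT huv hk.1 hk.2 hw
  · intro hw
    rcases Br_cases hT huv hw with h | ⟨k, hk, hku, h⟩
    · exact Or.inl h
    · exact Or.inr ⟨k, ⟨hk, hku⟩, h⟩

theorem KS_univ (hT : T.IsTree) (v : V) : KS T v {k | T.Adj v k} = Set.univ := by
  ext w
  simp only [Set.mem_univ, iff_true]
  by_cases h : w = v
  · exact Or.inl h
  · obtain ⟨k, hk, hw⟩ := Br_cover hT h
    exact Or.inr ⟨k, hk, hw⟩

end branches

section claws
variable {V : Type*} {T : SimpleGraph V}

/-- a claw given by its center and leaves -/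
def IsCl {V : Type*} (T : SimpleGraph V) (A : Set V) : Prop :=
  ∃ c x y z, T.Adj c x ∧ T.Adj c y ∧ T.Adj c z ∧ x ≠ y ∧ x ≠ z ∧ y ≠ z ∧ A = {c, x, y, z}

def HasClaw {V : Type*} (T : SimpleGraph V) (X : Set V) : Prop := ∃ A ⊆ X, IsCl T A

def TwoClaw {V : Type*} (T : SimpleGraph V) (X : Set V) : Prop :=
  ∃ A B, A ⊆ X ∧ B ⊆ X ∧ IsCl T A ∧ IsCl T B ∧ Disjoint A B

theorem HasClaw.mono {X Y : Set V} (h : HasClaw T X) (hXY : X ⊆ Y) : HasClaw T Y := by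
  obtain ⟨A, hA, h⟩ := h
  exact ⟨A, hA.trans hXY, h⟩

theorem TwoClaw.mono {X Y : Set V} (h : TwoClaw T X) (hXY : X ⊆ Y) : TwoClaw T Y := by
  obtain ⟨A, B, hA, hB, h⟩ := h
  exact ⟨A, B, hA.trans hXY, hB.trans hXY, h⟩

theorem isCl_mk {c x y z : V} (h1 : T.Adj c x) (h2 : T.Adj c y) (h3 : T.Adj c z)
    (hxy : x ≠ y) (hxz : x ≠ z) (hyz : y ≠ z) : IsCl T {c, x, y, z} :=
  ⟨c, x, y, z, h1, h2, h3, hxy, hxz, hyz, rfl⟩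

theorem no_tri (hT : T.IsTree) {a b c : V} (h1 : T.Adj a b) (h2 : T.Adj a c) (h : b ≠ c) :
    ¬ T.Adj b c := by
  intro h3
  refine Br_key hT h1 h2 h ⟨Walk.cons h3 Walk.nil, ?_⟩
  simp [h1.ne, h2.ne]

theorem IsCl.isClawSet (hT : T.IsTree) {A : Set V} (h : IsCl T A) : IsClawSet T A := by
  obtain ⟨c, x, y, z, h1, h2, h3, hxy, hxz, hyz, rfl⟩ := h
  have hn1 := no_tri hT h1 h2 hxy
  have hn2 := no_tri hT h1 h3 hxz
  have hn3 := no_tri hT h2 h3 hyz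
  have hn1' : ¬ T.Adj y x := fun h => hn1 h.symm
  have hn2' : ¬ T.Adj z x := fun h => hn2 h.symm
  have hn3' : ¬ T.Adj z y := fun h => hn3 h.symm
  let f : Fin 1 ⊕ Fin 3 → V := Sum.elim (fun _ => c) ![x, y, z]
  have hinj : Function.Injective f := by
    rintro (i | i) (j | j) hij
    · exact congrArg _ (Subsingleton.elim _ _)
    · fin_cases j <;> simp [f, h1.ne, h2.ne, h3.ne] at hij
    · fin_cases i <;> simp [f, h1.ne', h2.ne', h3.ne'] at hij
    · fin_cases i <;> fin_cases j <;> simp [f, hxy, hxz, hyz, hxy.symm, hxz.symm, hyz.symm] at hij ⊢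
  have hadj : ∀ i j, T.Adj (f i) (f j) ↔ clawGraph.Adj i j := by
    rintro (i | i) (j | j)
    · simp [f, clawGraph]
    · fin_cases j <;> simp [f, clawGraph, h1, h2, h3]
    · fin_cases i <;> simp [f, clawGraph, h1.symm, h2.symm, h3.symm]
    · fin_cases i <;> fin_cases j <;>
        simp [f, clawGraph, hn1, hn2, hn3, hn1', hn2', hn3']
  let e : clawGraph ↪g T := ⟨⟨f, hinj⟩, fun {a b} => hadj a b⟩
  have hr : Set.range e = {c, x, y, z} := by
    ext w
    constructor
    · rintro ⟨i | i, rfl⟩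
      · exact Or.inl rfl
      · fin_cases i
        · exact Or.inr (Or.inl rfl)
        · exact Or.inr (Or.inr (Or.inl rfl))
        · exact Or.inr (Or.inr (Or.inr rfl))
    · rintro (rfl | rfl | rfl | rfl)
      · exact ⟨Sum.inl 0, rfl⟩
      · exact ⟨Sum.inr 0, rfl⟩
      · exact ⟨Sum.inr 1, rfl⟩
      · exact ⟨Sum.inr 2, rfl⟩
  have e2 := e.isoInduceRange.symm
  rw [hr] at e2
  exact ⟨e2⟩

theorem IsCl.nonempty {A : Set V} (h : IsCl T A) : A.Nonempty := by
  obtain ⟨c, x, y, z, -, -, -, -, -, -, rfl⟩ := h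
  exact ⟨c, Or.inl rfl⟩

theorem IsCl.ncard {A : Set V} (h : IsCl T A) : A.ncard = 4 := by
  classical
  obtain ⟨c, x, y, z, h1, h2, h3, hxy, hxz, hyz, rfl⟩ := h
  rw [Set.ncard_eq_toFinset_card']
  simp [Finset.card_insert_of_notMem, h1.ne, h2.ne, h3.ne, hxy, hxz, hyz]

theorem IsCl.connected {A : Set V} (h : IsCl T A) : (T.induce A).Connected := by
  obtain ⟨c, x, y, z, h1, h2, h3, hxy, hxz, hyz, rfl⟩ := h
  refine induce_connected_of_patches c (Or.inl rfl) ?_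
  have key : ∀ w, T.Adj c w → w ∈ ({c, x, y, z} : Set V) →
      ∃ s' ⊆ ({c, x, y, z} : Set V), ∃ (hu : c ∈ s') (hv : w ∈ s'),
        (T.induce s').Reachable ⟨c, hu⟩ ⟨w, hv⟩ := by
    intro w hw hm
    refine ⟨{c, w}, ?_, Or.inl rfl, Or.inr rfl, ?_⟩
    · rintro a (rfl | rfl)
      · exact Or.inl rfl
      · exact hm
    · exact (induce_pair_connected_of_adj hw).preconnected _ _
  intro w hw
  by_cases hc : w = c
  · subst hc
    exact ⟨_, subset_rfl, hw, hw, Reachable.refl _⟩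
  · refine key w ?_ hw
    rcases hw with rfl | rfl | rfl | rfl
    · exact absurd rfl hc
    · exact h1
    · exact h2
    · exact h3

theorem IsCl.notPath {A : Set V} (h : IsCl T A) : ¬ IsPathGraph (T.induce A) := by
  rintro ⟨n, ⟨e⟩⟩
  obtain ⟨c, x, y, z, h1, h2, h3, hxy, hxz, hyz, rfl⟩ := h
  have m1 : c ∈ ({c, x, y, z} : Set V) := Or.inl rfl
  have m2 : x ∈ ({c, x, y, z} : Set V) := Or.inr (Or.inl rfl)
  have m3 : y ∈ ({c, x, y, z} : Set V) := Or.inr (Or.inr (Or.inl rfl))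
  have m4 : z ∈ ({c, x, y, z} : Set V) := Or.inr (Or.inr (Or.inr rfl))
  have a1 := (e.map_adj_iff (v := ⟨c, m1⟩) (w := ⟨x, m2⟩)).2 h1
  have a2 := (e.map_adj_iff (v := ⟨c, m1⟩) (w := ⟨y, m3⟩)).2 h2
  have a3 := (e.map_adj_iff (v := ⟨c, m1⟩) (w := ⟨z, m4⟩)).2 h3
  have d1 : (e ⟨x, m2⟩).val ≠ (e ⟨y, m3⟩).val := fun h => hxy (by
    simpa using e.injective (Fin.ext h))
  have d2 : (e ⟨x, m2⟩).val ≠ (e ⟨z, m4⟩).val := fun h => hxz (by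
    simpa using e.injective (Fin.ext h))
  have d3 : (e ⟨y, m3⟩).val ≠ (e ⟨z, m4⟩).val := fun h => hyz (by
    simpa using e.injective (Fin.ext h))
  rw [pathGraph_adj] at a1 a2 a3
  omega

/-- a claw in `Br u v` missing `v` lies in a child branch -/
theorem claw_child (hT : T.IsTree) {v : V} {A : Set V} (hA : IsCl T A) (hv : v ∉ A) :
    ∃ k, T.Adj v k ∧ A ⊆ Br T v k := by
  obtain ⟨c, x, y, z, h1, h2, h3, hxy, hxz, hyz, rfl⟩ := hA
  simp only [Set.mem_insert_iff, Set.mem_singleton_iff, not_or] at hv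
  obtain ⟨k, hk, hc⟩ := Br_cover hT (w := c) (v := v) (fun h => hv.1 h.symm)
  refine ⟨k, hk, ?_⟩
  rintro w (rfl | rfl | rfl | rfl)
  · exact hc
  · exact Br_step hc h1 (fun h => hv.2.1 h.symm)
  · exact Br_step hc h2 (fun h => hv.2.2.1 h.symm)
  · exact Br_step hc h3 (fun h => hv.2.2.2 h.symm)

theorem closedNbhd_sub {u v : V} {A : Set V} (hA : A ⊆ Br T u v) (hT : T.IsTree)
    (huv : T.Adj u v) (hv : v ∉ A) : closedNbhd T A ⊆ Br T u v := by
  rintro w (hw | ⟨s, hs, hsw⟩)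
  · exact hA hw
  · refine Br_step (hA hs) hsw ?_
    rintro rfl
    exact hv (Br_root hT huv (hA hs) hsw ▸ hs)

def Heavy {V : Type*} (T : SimpleGraph V) (m k : V) : Prop := HasClaw T (Br T m k \ {k})

theorem walk_avoid (hT : T.IsTree) {m k w : V} (hk : T.Adj m k) (hw : w ∉ Br T m k) :
    ∃ p : T.Walk m w, ∀ x ∈ p.support, x ∉ Br T m k := by
  have := (Br_opp hT hk).2 hw
  obtain ⟨p, hp⟩ := Br_joins (Br_self hk.ne') this
  exact ⟨p, fun x hx => (Br_opp hT hk).1 (hp x hx)⟩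

theorem npd_of_heavy (hT : T.IsTree) (ha : ¬ ∃ A B C : Set V, NpdConfig T A B C)
    (m : V) (k : Fin 3 → V) (hk : ∀ i, T.Adj m (k i)) (hinj : Function.Injective k)
    (hh : ∀ i, Heavy T m (k i)) : False := by
  choose A hA hcl using hh
  have hs : ∀ i, A i ⊆ Br T m (k i) := fun i x hx => (hA i hx).1
  have hn : ∀ i, k i ∉ A i := fun i hx => (hA i hx).2 rfl
  have hN : ∀ i, closedNbhd T (A i) ⊆ Br T m (k i) := fun i =>
    closedNbhd_sub (hs i) hT (hk i) (hn i)
  have hout : ∀ i j, j ≠ i → ∀ x ∈ A j, x ∉ Br T m (k i) := fun i j hij x hx h =>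
    Br_disj hT (hk j) (hk i) (fun h => hij (hinj h)) (hs j hx) h
  have hp : ∀ i, pick3 (A 0) (A 1) (A 2) i = A i := by
    intro i; fin_cases i <;> simp [pick3]
  refine ha ⟨A 0, A 1, A 2, (hcl 0).nonempty, (hcl 1).nonempty, (hcl 2).nonempty, ?_⟩
  intro i
  have hp' : pick3 (A 0) (A 1) (A 2) = A := funext hp
  rw [hp']
  refine ⟨?_, (hcl i).connected, (hcl i).notPath, ?_⟩
  · intro j hj
    rw [Set.disjoint_left]
    intro x hx hxj
    exact hout i j hj x hxj (hN i hx)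
  · intro j l hj hl a ha b hb
    obtain ⟨p, hp⟩ := walk_avoid hT (hk i) (hout i j hj a ha)
    obtain ⟨q, hq⟩ := walk_avoid hT (hk i) (hout i l hl b hb)
    refine ⟨p.reverse.append q, ?_⟩
    intro x hx hxN
    rw [Walk.mem_support_append_iff] at hx
    rcases hx with hx | hx
    · exact hp x (by simpa using hx) (hN i hxN)
    · exact hq x hx (hN i hxN)

/-- general source of `NdsConfig` -/
theorem nds_of_edge (hT : T.IsTree) (hb : ¬ ∃ A B C D : Set V, NdsConfig T A B C D)
    {u v : V} (huv : T.Adj u v) {A B C D : Set V}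
    (cA : IsCl T A) (cB : IsCl T B) (cC : IsCl T C) (cD : IsCl T D)
    (hA : A ⊆ Br T v u) (hB : B ⊆ Br T v u) (hC : C ⊆ Br T u v) (hD : D ⊆ Br T u v)
    (hAB : Disjoint A B) (hCD : Disjoint C D)
    (hP : ∃ a ∈ A, ∃ b ∈ B, ∃ p : T.Walk a b,
      ∀ x ∈ p.support, x ∈ Br T v u ∧ (v ∈ C ∪ D → x ≠ u))
    (hQ : ∃ a ∈ C, ∃ b ∈ D, ∃ p : T.Walk a b,
      ∀ x ∈ p.support, x ∈ Br T u v ∧ (u ∈ A ∪ B → x ≠ v))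
    (hl : u ∈ A ∪ B → v ∈ C ∪ D →
      (IsClawLeaf T A u ∨ IsClawLeaf T B u) ∧ (IsClawLeaf T C v ∨ IsClawLeaf T D v)) :
    False := by
  classical
  have dd : ∀ {X Y : Set V}, X ⊆ Br T v u → Y ⊆ Br T u v → Disjoint X Y := by
    intro X Y hX hY
    rw [Set.disjoint_left]
    intro x hx hy
    exact (Br_opp hT huv).1 (hX hx) (hY hy)
  have hABs : A ∪ B ⊆ Br T v u := Set.union_subset hA hB
  have hCDs : C ∪ D ⊆ Br T u v := Set.union_subset hC hD
  refine hb ⟨A, B, C, D, ⟨cA.isClawSet hT, cB.isClawSet hT, cC.isClawSet hT, cD.isClawSet hT,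
    hAB, dd hA hC, dd hA hD, dd hB hC, dd hB hD, hCD, ?_, ?_, ?_⟩, ?_⟩
  · obtain ⟨a, ha, b, hb, p, hp⟩ := hP
    refine ⟨a, ha, b, hb, p.bypass, p.bypass_isPath, ?_⟩
    intro x hx hN
    obtain ⟨h1, h2⟩ := hp x (p.support_bypass_subset_support hx)
    rcases hN with h | ⟨s, hs, hsx⟩
    · exact (Br_opp hT huv).1 h1 (hCDs h)
    · obtain ⟨e1, e2⟩ := Br_root' hT huv h1 (hCDs hs) hsx.symm
      subst e2
      exact h2 hs e1
  · obtain ⟨a, ha, b, hb, p, hp⟩ := hQ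
    refine ⟨a, ha, b, hb, p.bypass, p.bypass_isPath, ?_⟩
    intro x hx hN
    obtain ⟨h1, h2⟩ := hp x (p.support_bypass_subset_support hx)
    rcases hN with h | ⟨s, hs, hsx⟩
    · exact (Br_opp hT huv).1 (hABs h) h1
    · obtain ⟨e1, e2⟩ := Br_root' hT huv (hABs hs) h1 hsx
      subst e1
      exact h2 hs e2
  · intro x hx y hy hxy x' hx' y' hy' hxy'
    obtain ⟨e1, e2⟩ := Br_root' hT huv (hABs hx) (hCDs hy) hxy
    obtain ⟨e3, e4⟩ := Br_root' hT huv (hABs hx') (hCDs hy') hxy'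
    exact ⟨e1.trans e3.symm, e2.trans e4.symm⟩
  · intro x hx y hy hxy
    obtain ⟨e1, e2⟩ := Br_root' hT huv (hABs hx) (hCDs hy) hxy
    subst e1 e2
    exact hl hx hy

theorem br_path {u v : V} {A B X : Set V} (hA : A ⊆ Br T u v) (hB : B ⊆ Br T u v)
    (cA : IsCl T A) (cB : IsCl T B) (hX : Br T u v ⊆ X) :
    ∃ a ∈ A, ∃ b ∈ B, ∃ p : T.Walk a b, ∀ x ∈ p.support, x ∈ X := by
  obtain ⟨a, ha⟩ := cA.nonempty
  obtain ⟨b, hb⟩ := cB.nonempty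
  obtain ⟨p, hp⟩ := Br_joins (hA ha) (hB hb)
  exact ⟨a, ha, b, hb, p, fun x hx => hX (hp x hx)⟩

theorem two_unique (hT : T.IsTree) (hb : ¬ ∃ A B C D : Set V, NdsConfig T A B C D)
    {u v j : V} (hv : T.Adj u v) (hj : T.Adj u j) (hne : j ≠ v)
    (h1 : TwoClaw T (Br T u v)) (h2 : TwoClaw T (Br T u j)) : False := by
  obtain ⟨A, B, hA, hB, cA, cB, dAB⟩ := h2
  obtain ⟨C, D, hC, hD, cC, cD, dCD⟩ := h1
  have hs := Br_sub hT hv.symm hj hne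
  have hu : u ∉ A ∪ B := by
    rintro (h | h)
    · exact Br_not (hA h)
    · exact Br_not (hB h)
  refine nds_of_edge hT hb hv cA cB cC cD (hA.trans hs) (hB.trans hs) hC hD dAB dCD ?_ ?_ ?_
  · refine br_path hA hB cA cB (X := {x | x ∈ Br T v u ∧ (v ∈ C ∪ D → x ≠ u)}) ?_
    intro x hx
    refine ⟨hs hx, fun _ h => ?_⟩
    subst h
    exact Br_not hx
  · refine br_path hC hD cC cD (X := {x | x ∈ Br T u v ∧ (u ∈ A ∪ B → x ≠ v)}) ?_
    exact fun x hx => ⟨hx, fun h => absurd h hu⟩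
  · exact fun h => absurd h hu

theorem pp (hT : T.IsTree) (hb : ¬ ∃ A B C D : Set V, NdsConfig T A B C D)
    {u v j j' k k' : V} (hv : T.Adj u v) (hj : j ∈ Kd T v u) (hj' : j' ∈ Kd T v u) (hjj : j ≠ j')
    (hk : k ∈ Kd T u v) (hk' : k' ∈ Kd T u v) (hkk : k ≠ k')
    (h1 : HasClaw T (Br T u j)) (h2 : HasClaw T (Br T u j'))
    (h3 : HasClaw T (Br T v k)) (h4 : HasClaw T (Br T v k')) : False := by
  obtain ⟨A, hA, cA⟩ := h1
  obtain ⟨B, hB, cB⟩ := h2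
  obtain ⟨C, hC, cC⟩ := h3
  obtain ⟨D, hD, cD⟩ := h4
  have hA' := hA.trans (Br_sub hT hv.symm hj.1 hj.2)
  have hB' := hB.trans (Br_sub hT hv.symm hj'.1 hj'.2)
  have hC' := hC.trans (Br_sub hT hv hk.1 hk.2)
  have hD' := hD.trans (Br_sub hT hv hk'.1 hk'.2)
  have hu : u ∉ A ∪ B := by
    rintro (h | h)
    · exact Br_not (hA h)
    · exact Br_not (hB h)
  have hv' : v ∉ C ∪ D := by
    rintro (h | h)
    · exact Br_not (hC h)
    · exact Br_not (hD h)
  refine nds_of_edge hT hb hv cA cB cC cD hA' hB' hC' hD' ?_ ?_ ?_ ?_ ?_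
  · exact Set.disjoint_left.2 fun x hx hx' => Br_disj hT hj.1 hj'.1 hjj (hA hx) (hB hx')
  · exact Set.disjoint_left.2 fun x hx hx' => Br_disj hT hk.1 hk'.1 hkk (hC hx) (hD hx')
  · exact br_path hA' hB' cA cB (X := {x | x ∈ Br T v u ∧ (v ∈ C ∪ D → x ≠ u)})
      fun x hx => ⟨hx, fun h => absurd h hv'⟩
  · exact br_path hC' hD' cC cD (X := {x | x ∈ Br T u v ∧ (u ∈ A ∪ B → x ≠ v)})
      fun x hx => ⟨hx, fun h => absurd h hu⟩
  · exact fun h => absurd h hu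

/-- failing of `S(u,j)` gives a leaf-type pair -/
theorem leaf_pair (hT : T.IsTree) {u j : V} (hj : T.Adj u j) (h1 : ¬ TwoClaw T (Br T u j))
    (h2 : TwoClaw T (insert u (Br T u j))) :
    ∃ A B, IsCl T A ∧ IsCl T B ∧ Disjoint A B ∧ A ⊆ insert u (Br T u j) ∧ B ⊆ Br T u j ∧
      IsClawLeaf T A u ∧ j ∈ A := by
  have main : ∀ A B, IsCl T A → IsCl T B → Disjoint A B → A ⊆ insert u (Br T u j) →
      B ⊆ insert u (Br T u j) → u ∈ A → ∃ A B, IsCl T A ∧ IsCl T B ∧ Disjoint A B ∧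
      A ⊆ insert u (Br T u j) ∧ B ⊆ Br T u j ∧ IsClawLeaf T A u ∧ j ∈ A := by
    intro A B cA cB hd hA hB hu
    have hB' : B ⊆ Br T u j := by
      intro x hx
      rcases hB hx with rfl | h
      · exact absurd hx (Set.disjoint_left.1 hd hu)
      · exact h
    refine ⟨A, B, cA, cB, hd, hA, hB', ?_⟩
    -- every neighbour of u in A is j
    have hone : ∀ w ∈ A, T.Adj u w → w = j := by
      intro w hw hadj
      rcases hA hw with rfl | h
      · exact absurd hadj (T.loopless.irrefl _)
      · exact Br_root hT hj h hadj.symm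
    obtain ⟨c, x, y, z, h1, h2, h3, hxy, hxz, hyz, rfl⟩ := cA
    have mx : x ∈ ({c, x, y, z} : Set V) := Or.inr (Or.inl rfl)
    have my : y ∈ ({c, x, y, z} : Set V) := Or.inr (Or.inr (Or.inl rfl))
    have mz : z ∈ ({c, x, y, z} : Set V) := Or.inr (Or.inr (Or.inr rfl))
    have mc : c ∈ ({c, x, y, z} : Set V) := Or.inl rfl
    constructor
    · refine ⟨hu, fun hc => ?_⟩
      have : ∀ w ∈ ({c, x, y, z} : Set V), w ≠ u → w = j := fun w hw hne =>
        hone w hw (hc.2 w hw hne)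
      have e1 := this _ mx
      have e2 := this _ my
      have e3 := this _ mz
      by_cases hx : x = u
      · subst hx
        exact hyz ((e2 hxy.symm).trans (e3 hxz.symm).symm)
      · by_cases hy : y = u
        · subst hy
          exact hxz ((e1 hx).trans (e3 hyz.symm).symm)
        · exact hxy ((e1 hx).trans (e2 hy).symm)
    · have huc : u ≠ c := by
        rintro rfl
        exact hxy ((hone _ mx h1).trans (hone _ my h2).symm)
      have : T.Adj u c := by
        rcases hu with h | rfl | rfl | rfl
        · exact absurd h huc
        · exact h1.symm
        · exact h2.symm
        · exact h3.symm
      exact (hone _ mc this) ▸ mc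
  obtain ⟨A, B, hA, hB, cA, cB, hd⟩ := h2
  by_cases huA : u ∈ A
  · exact main A B cA cB hd hA hB huA
  by_cases huB : u ∈ B
  · exact main B A cB cA hd.symm hB hA huB
  refine absurd ⟨A, B, ?_, ?_, cA, cB, hd⟩ h1
  · intro x hx
    rcases hA hx with rfl | h
    · exact absurd hx huA
    · exact h
  · intro x hx
    rcases hB hx with rfl | h
    · exact absurd hx huB
    · exact h

theorem ll (hT : T.IsTree) (hb : ¬ ∃ A B C D : Set V, NdsConfig T A B C D)
    {u v j k : V} (hv : T.Adj u v) (hj : j ∈ Kd T v u) (hk : k ∈ Kd T u v)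
    (h1 : ¬ TwoClaw T (Br T u j)) (h2 : TwoClaw T (insert u (Br T u j)))
    (h3 : ¬ TwoClaw T (Br T v k)) (h4 : TwoClaw T (insert v (Br T v k))) : False := by
  obtain ⟨A, B, cA, cB, dAB, hA, hB, lA, jA⟩ := leaf_pair hT hj.1 h1 h2
  obtain ⟨C, D, cC, cD, dCD, hC, hD, lC, kC⟩ := leaf_pair hT hk.1 h3 h4
  have hjs := Br_sub hT hv.symm hj.1 hj.2
  have hks := Br_sub hT hv hk.1 hk.2
  refine nds_of_edge hT hb hv cA cB cC cD ?_ (hB.trans hjs) ?_ (hD.trans hks) dAB dCD ?_ ?_ ?_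
  · exact hA.trans (Set.insert_subset (Br_self hv.ne') hjs)
  · exact hC.trans (Set.insert_subset (Br_self hv.ne) hks)
  · obtain ⟨b, hb⟩ := cB.nonempty
    obtain ⟨p, hp⟩ := Br_joins (Br_self hj.1.ne) (hB hb)
    refine ⟨j, jA, b, hb, p, fun x hx => ⟨hjs (hp x hx), fun _ h => ?_⟩⟩
    subst h
    exact Br_not (hp _ hx)
  · obtain ⟨b, hb⟩ := cD.nonempty
    obtain ⟨p, hp⟩ := Br_joins (Br_self hk.1.ne) (hD hb)
    refine ⟨k, kC, b, hb, p, fun x hx => ⟨hks (hp x hx), fun _ h => ?_⟩⟩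
    subst h
    exact Br_not (hp _ hx)
  · exact fun _ _ => ⟨Or.inl lA, Or.inl lC⟩

end claws

section models
variable {V W : Type*} {T : SimpleGraph V} {G : SimpleGraph W}

/-- rooted induced minor models -/
def RM {V W : Type*} (T : SimpleGraph V) (G : SimpleGraph W) (S : Set V) (v : V) (Z : Set W)
    (z : W) : Prop :=
  ∃ M : V → Set W, (∀ w ∈ S, M w ⊆ Z ∧ (G.induce (M w)).Connected) ∧
    (∀ w ∈ S, ∀ w' ∈ S, w ≠ w' → Disjoint (M w) (M w')) ∧
    (∀ w ∈ S, ∀ w' ∈ S, w ≠ w' → ((∃ a ∈ M w, ∃ b ∈ M w', G.Adj a b) ↔ T.Adj w w')) ∧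
    z ∈ M v

theorem RM_base (v : V) (z : W) : RM T G {v} v {z} z := by
  refine ⟨fun _ => {z}, ?_, ?_, ?_, rfl⟩
  · intro w _
    refine ⟨subset_rfl, ?_⟩
    have : Subsingleton (({z} : Set W) : Type _) := ⟨fun a b => Subtype.ext (a.2.trans b.2.symm)⟩
    have : Nonempty (({z} : Set W) : Type _) := ⟨⟨z, rfl⟩⟩
    exact ⟨fun a b => by rw [Subsingleton.elim a b]⟩
  · rintro w rfl w' rfl h
    exact absurd rfl h
  · rintro w rfl w' rfl h
    exact absurd rfl h

theorem RM_mono {S : Set V} {v : V} {Z Z' : Set W} {z : W} (h : RM T G S v Z z) (hZ : Z ⊆ Z') :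
    RM T G S v Z' z := by
  obtain ⟨M, h1, h2⟩ := h
  exact ⟨M, fun w hw => ⟨(h1 w hw).1.trans hZ, (h1 w hw).2⟩, h2⟩

theorem RM_add {S1 S2 : Set V} {v k : V} {Z1 Z2 : Set W} {z f : W}
    (h1 : RM T G S1 v Z1 z) (h2 : RM T G S2 k Z2 f) (hS : Disjoint S1 S2) (hZ : Disjoint Z1 Z2)
    (hv : v ∈ S1) (hk : k ∈ S2) (hvk : T.Adj v k) (hzf : G.Adj z f)
    (eT : ∀ a ∈ S1, ∀ b ∈ S2, T.Adj a b → a = v ∧ b = k)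
    (eG : ∀ a ∈ Z1, ∀ b ∈ Z2, G.Adj a b → a = z ∧ b = f) :
    RM T G (S1 ∪ S2) v (Z1 ∪ Z2) z := by
  classical
  obtain ⟨M1, a1, b1, c1, d1⟩ := h1
  obtain ⟨M2, a2, b2, c2, d2⟩ := h2
  have hS' : ∀ w ∈ S2, w ∉ S1 := fun w hw hw' => Set.disjoint_left.1 hS hw' hw
  let M : V → Set W := fun w => if w ∈ S1 then M1 w else M2 w
  have e1 : ∀ w ∈ S1, M w = M1 w := fun w hw => if_pos hw
  have e2 : ∀ w ∈ S2, M w = M2 w := fun w hw => if_neg (hS' w hw)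
  have dz : ∀ w ∈ S1, ∀ w' ∈ S2, Disjoint (M1 w) (M2 w') := fun w hw w' hw' =>
    hZ.mono (a1 w hw).1 (a2 w' hw').1
  have cz : ∀ w ∈ S1, ∀ w' ∈ S2, ((∃ a ∈ M1 w, ∃ b ∈ M2 w', G.Adj a b) ↔ T.Adj w w') := by
    intro w hw w' hw'
    constructor
    · rintro ⟨a, ha, b, hb, hab⟩
      obtain ⟨rfl, rfl⟩ := eG a ((a1 w hw).1 ha) b ((a2 w' hw').1 hb) hab
      have e3 : w = v := by
        by_contra hne
        exact Set.disjoint_left.1 (b1 w hw v hv hne) ha d1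
      have e4 : w' = k := by
        by_contra hne
        exact Set.disjoint_left.1 (b2 w' hw' k hk hne) hb d2
      rw [e3, e4]; exact hvk
    · intro hadj
      obtain ⟨rfl, rfl⟩ := eT w hw w' hw' hadj
      exact ⟨z, d1, f, d2, hzf⟩
  refine ⟨M, ?_, ?_, ?_, ?_⟩
  · rintro w (hw | hw)
    · rw [e1 w hw]
      exact ⟨(a1 w hw).1.trans Set.subset_union_left, (a1 w hw).2⟩
    · rw [e2 w hw]
      exact ⟨(a2 w hw).1.trans Set.subset_union_right, (a2 w hw).2⟩
  · rintro w (hw | hw) w' (hw' | hw') hne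
    · rw [e1 w hw, e1 w' hw']; exact b1 w hw w' hw' hne
    · rw [e1 w hw, e2 w' hw']; exact dz w hw w' hw'
    · rw [e2 w hw, e1 w' hw']; exact (dz w' hw' w hw).symm
    · rw [e2 w hw, e2 w' hw']; exact b2 w hw w' hw' hne
  · rintro w (hw | hw) w' (hw' | hw') hne
    · rw [e1 w hw, e1 w' hw']; exact c1 w hw w' hw' hne
    · rw [e1 w hw, e2 w' hw']; exact cz w hw w' hw'
    · rw [e2 w hw, e1 w' hw', T.adj_comm, ← cz w' hw' w hw]
      constructor
      · rintro ⟨a, ha, b, hb, hab⟩; exact ⟨b, hb, a, ha, hab.symm⟩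
      · rintro ⟨a, ha, b, hb, hab⟩; exact ⟨b, hb, a, ha, hab.symm⟩
    · rw [e2 w hw, e2 w' hw']; exact c2 w hw w' hw' hne
  · rw [e1 v hv]; exact d1

theorem RM_contract {S : Set V} {v : V} {Z : Set W} {z f : W}
    (h : RM T G S v Z f) (hv : v ∈ S) (hz : z ∉ Z) (hzf : G.Adj z f)
    (hN : ∀ b ∈ Z, G.Adj z b → b = f) : RM T G S v (insert z Z) z := by
  classical
  obtain ⟨M1, a1, b1, c1, d1⟩ := h
  let M : V → Set W := fun w => if w = v then insert z (M1 v) else M1 w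
  have e1 : M v = insert z (M1 v) := if_pos rfl
  have e2 : ∀ w, w ≠ v → M w = M1 w := fun w hw => if_neg hw
  have dv : ∀ w ∈ S, w ≠ v → Disjoint (insert z (M1 v)) (M1 w) := by
    intro w hw hne
    rw [Set.disjoint_left]
    rintro a (rfl | ha) ha'
    · exact hz ((a1 w hw).1 ha')
    · exact Set.disjoint_left.1 (b1 w hw v hv hne) ha' ha
  have cv : ∀ w ∈ S, w ≠ v →
      ((∃ a ∈ insert z (M1 v), ∃ b ∈ M1 w, G.Adj a b) ↔ T.Adj v w) := by
    intro w hw hne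
    rw [← c1 v hv w hw hne.symm]
    constructor
    · rintro ⟨a, rfl | ha, b, hb, hab⟩
      · have := hN b ((a1 w hw).1 hb) hab
        subst this
        exact absurd d1 (Set.disjoint_left.1 (b1 w hw v hv hne) hb)
      · exact ⟨a, ha, b, hb, hab⟩
    · rintro ⟨a, ha, b, hb, hab⟩
      exact ⟨a, Or.inr ha, b, hb, hab⟩
  refine ⟨M, ?_, ?_, ?_, ?_⟩
  · intro w hw
    by_cases hwv : w = v
    · subst hwv
      rw [e1]
      refine ⟨Set.insert_subset_insert (a1 w hw).1, ?_⟩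
      have := induce_union_connected (induce_pair_connected_of_adj hzf).preconnected
        (a1 w hw).2.preconnected
        ⟨f, Or.inr rfl, d1⟩
      have h3 : ({z, f} ∪ M1 w : Set W) = insert z (M1 w) := by
        ext x
        simp only [Set.mem_union, Set.mem_insert_iff, Set.mem_singleton_iff]
        constructor
        · rintro ((h | rfl) | h)
          · exact Or.inl h
          · exact Or.inr d1
          · exact Or.inr h
        · rintro (h | h)
          · exact Or.inl (Or.inl h)
          · exact Or.inr h
      rw [← h3]
      exact this
    · rw [e2 w hwv]
      exact ⟨(a1 w hw).1.trans (Set.subset_insert _ _), (a1 w hw).2⟩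
  · intro w hw w' hw' hne
    by_cases hwv : w = v
    · subst hwv
      rw [e1, e2 w' hne.symm]
      exact dv w' hw' hne.symm
    · by_cases hwv' : w' = v
      · subst hwv'
        rw [e1, e2 w hne]
        exact (dv w hw hne).symm
      · rw [e2 w hwv, e2 w' hwv']
        exact b1 w hw w' hw' hne
  · intro w hw w' hw' hne
    by_cases hwv : w = v
    · subst hwv
      rw [e1, e2 w' hne.symm]
      exact cv w' hw' hne.symm
    · by_cases hwv' : w' = v
      · subst hwv'
        rw [e1, e2 w hne, T.adj_comm, ← cv w hw hne]
        constructor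
        · rintro ⟨a, ha, b, hb, hab⟩; exact ⟨b, hb, a, ha, hab.symm⟩
        · rintro ⟨a, ha, b, hb, hab⟩; exact ⟨b, hb, a, ha, hab.symm⟩
      · rw [e2 w hwv, e2 w' hwv']
        exact c1 w hw w' hw' hne
  · rw [e1]; exact Or.inl rfl

theorem RM_final {v : V} {Z : Set W} {z : W} (h : RM T G Set.univ v Z z) : InducedMinor T G := by
  obtain ⟨M, a, b, c, d⟩ := h
  refine ⟨M, ?_, fun w => (a w trivial).2, fun w w' hne => b w trivial w' trivial hne,
    fun w w' hne => c w trivial w' trivial hne⟩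
  intro w
  have := (a w trivial).2.nonempty
  exact Set.nonempty_coe_sort.1 this

/-- host rootedness -/
structure Host {W : Type*} (G : SimpleGraph W) (dep : W → ℕ) : Prop where
  h1 : ∀ a b, G.Adj a b → dep a ≠ dep b
  h2 : ∀ a b b', G.Adj a b → G.Adj a b' → dep b < dep a → dep b' < dep a → b = b'

def ch {W : Type*} (G : SimpleGraph W) (dep : W → ℕ) (z : W) : Set W :=
  {f | G.Adj z f ∧ dep z < dep f}

def De {W : Type*} (G : SimpleGraph W) (dep : W → ℕ) (f : W) : Set W :=
  {w | Relation.ReflTransGen (fun a b => b ∈ ch G dep a) f w}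

def HS {W : Type*} (G : SimpleGraph W) (dep : W → ℕ) (z : W) (F : Set W) : Set W :=
  {w | w = z ∨ ∃ f ∈ F, w ∈ De G dep f}

variable {dep : W → ℕ}

theorem De_self (f : W) : f ∈ De G dep f := Relation.ReflTransGen.refl

theorem De_dep {f w : W} (h : w ∈ De G dep f) : dep f ≤ dep w := by
  induction h with
  | refl => exact le_rfl
  | tail _ h ih => exact ih.trans h.2.le

theorem De_dep_lt {z f w : W} (hf : f ∈ ch G dep z) (h : w ∈ De G dep f) : dep z < dep w :=
  hf.2.trans_le (De_dep h)

theorem HS_ch (f : W) : HS G dep f (ch G dep f) = De G dep f := by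
  ext w
  constructor
  · rintro (rfl | ⟨g, hg, hw⟩)
    · exact De_self _
    · exact Relation.ReflTransGen.head hg hw
  · intro h
    rcases Relation.ReflTransGen.cases_head h with rfl | ⟨g, hg, hw⟩
    · exact Or.inl rfl
    · exact Or.inr ⟨g, hg, hw⟩

/-- an edge leaving a descendant set goes from its root to the parent -/
theorem De_edge (H : Host G dep) {z f a b : W} (hf : f ∈ ch G dep z) (ha : a ∈ De G dep f)
    (hb : b ∉ De G dep f) (hab : G.Adj a b) : a = f ∧ b = z := by
  have hlt : dep b < dep a := by
    rcases lt_or_gt_of_ne (H.h1 a b hab) with h | h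
    · exact absurd (Relation.ReflTransGen.tail ha ⟨hab, h⟩) hb
    · exact h
  rcases Relation.ReflTransGen.cases_tail ha with rfl | ⟨c, hc, hca⟩
  · exact ⟨rfl, H.h2 a b z hab hf.1.symm hlt hf.2⟩
  · have := H.h2 a b c hab hca.1.symm hlt hca.2
    subst this
    exact absurd hc hb

theorem De_disj (H : Host G dep) {z f g : W} (hf : f ∈ ch G dep z) (hg : g ∈ ch G dep z)
    (hne : f ≠ g) : Disjoint (De G dep f) (De G dep g) := by
  rw [Set.disjoint_left]
  intro w hw hw'
  induction hw with
  | refl =>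
    rcases Relation.ReflTransGen.cases_tail hw' with h | ⟨c, hc, hca⟩
    · exact hne h
    · have := H.h2 f c z hca.1.symm hf.1.symm hca.2 hf.2
      subst this
      exact absurd (De_dep_lt hg hc) (lt_irrefl _)
  | tail hb hbc ih =>
    rename_i b c
    rcases Relation.ReflTransGen.cases_tail hw' with h | ⟨d, hd, hda⟩
    · subst h
      have := H.h2 c b z hbc.1.symm hg.1.symm hbc.2 hg.2
      subst this
      exact absurd (De_dep_lt hf hb) (lt_irrefl _)
    · have := H.h2 c d b hda.1.symm hbc.1.symm hda.2 hbc.2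
      subst this
      exact ih hd

def R {V W : Type*} (T : SimpleGraph V) (G : SimpleGraph W) (dep : W → ℕ) (v : V) (K : Set V)
    (z : W) (F : Set W) : Prop := RM T G (KS T v K) v (HS G dep z F) z

theorem R_base (v : V) (z : W) : R T G dep v ∅ z ∅ := by
  unfold R
  have h1 : KS T v ∅ = {v} := by ext; simp [KS]
  have h2 : HS G dep z ∅ = {z} := by ext; simp [HS]
  rw [h1, h2]
  exact RM_base v z

theorem R_mono {v : V} {K : Set V} {z : W} {F F' : Set W} (h : R T G dep v K z F) (hF : F ⊆ F') :
    R T G dep v K z F' := by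
  refine RM_mono h ?_
  rintro w (h | ⟨f, hf, hw⟩)
  · exact Or.inl h
  · exact Or.inr ⟨f, hF hf, hw⟩

theorem R_add (hT : T.IsTree) (H : Host G dep) {v k : V} {K : Set V} {z f : W} {F : Set W}
    (h : R T G dep v K z F) (hK : ∀ j ∈ K, T.Adj v j) (hF : F ⊆ ch G dep z) (hk : T.Adj v k)
    (hkK : k ∉ K) (hf : f ∈ ch G dep z) (hfF : f ∉ F)
    (h2 : R T G dep k (Kd T v k) f (ch G dep f)) :
    R T G dep v (insert k K) z (insert f F) := by
  unfold R at h h2 ⊢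
  rw [KS_Kd hT hk, HS_ch] at h2
  have e1 : KS T v (insert k K) = KS T v K ∪ Br T v k := by
    ext w
    simp only [KS, Set.mem_ofPred_eq, Set.mem_union, Set.mem_insert_iff, exists_eq_or_imp]
    rw [or_assoc, or_comm (a := w ∈ _)]
  have e2 : HS G dep z (insert f F) = HS G dep z F ∪ De G dep f := by
    ext w
    simp only [HS, Set.mem_ofPred_eq, Set.mem_union, Set.mem_insert_iff, exists_eq_or_imp]
    rw [or_assoc, or_comm (a := w ∈ _)]
  have dS : Disjoint (KS T v K) (Br T v k) := by
    rw [Set.disjoint_left]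
    rintro w (rfl | ⟨j, hj, hw⟩) hw'
    · exact Br_not hw'
    · exact Br_disj hT (hK j hj) hk (fun h => hkK (h ▸ hj)) hw hw'
  have dZ : Disjoint (HS G dep z F) (De G dep f) := by
    rw [Set.disjoint_left]
    rintro w (rfl | ⟨g, hg, hw⟩) hw'
    · exact absurd (De_dep_lt hf hw') (lt_irrefl _)
    · exact Set.disjoint_left.1 (De_disj H (hF hg) hf (fun h => hfF (h ▸ hg))) hw hw'
  rw [e1, e2]
  refine RM_add h h2 dS dZ (Or.inl rfl) (Br_self hk.ne) hk hf.1 ?_ ?_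
  · intro a ha b hb hab
    have ha' := Set.disjoint_left.1 dS ha
    have := Br_edge hb ha' hab.symm
    subst this
    exact ⟨rfl, Br_root hT hk hb hab.symm⟩
  · intro a ha b hb hab
    have ha' := Set.disjoint_left.1 dZ ha
    have := De_edge H hf hb ha' hab.symm
    exact ⟨this.2, this.1⟩

theorem R_contract (H : Host G dep) {v : V} {K : Set V} {z f : W}
    (h : R T G dep v K f (ch G dep f)) (hf : f ∈ ch G dep z) : R T G dep v K z {f} := by
  unfold R at h ⊢
  rw [HS_ch] at h
  have hz : z ∉ De G dep f := fun hw => absurd (De_dep_lt hf hw) (lt_irrefl _)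
  have e : HS G dep z {f} = insert z (De G dep f) := by
    ext w; simp [HS]
  rw [e]
  exact RM_contract h (Or.inl rfl) hz hf.1 fun b hb hab => (De_edge H hf hb hz hab.symm).1

theorem R_multi (hT : T.IsTree) (H : Host G dep) {v : V} {K0 : Set V} {z : W} {F0 : Set W}
    (h : R T G dep v K0 z F0) (hK0 : ∀ j ∈ K0, T.Adj v j) (hF0 : F0 ⊆ ch G dep z)
    {K1 : Set V} (fK : K1.Finite) : ∀ {F1 : Set W}, (∀ j ∈ K1, T.Adj v j) → F1 ⊆ ch G dep z →
    Disjoint K1 K0 → Disjoint F1 F0 → F1.Finite → K1.ncard ≤ F1.ncard →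
    (∀ k ∈ K1, ∀ f ∈ F1, R T G dep k (Kd T v k) f (ch G dep f)) →
    R T G dep v (K1 ∪ K0) z (F1 ∪ F0) := by
  induction K1, fK using Set.Finite.induction_on with
  | empty =>
    intro F1 _ _ _ _ _ _ _
    rw [Set.empty_union]
    exact R_mono h Set.subset_union_right
  | @insert k K1 hk fK ih =>
    intro F1 hK hF dK dF fF hc hR
    rw [Set.ncard_insert_of_notMem hk fK] at hc
    have : F1.Nonempty := by
      rw [← Set.ncard_pos fF]; omega
    obtain ⟨f, hf⟩ := this
    have hc' := Set.ncard_sdiff_singleton_add_one hf fF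
    have h3 := ih (F1 := F1 \ {f}) (fun j hj => hK j (Or.inr hj))
      (Set.sdiff_subset.trans hF) (dK.mono_left (Set.subset_insert _ _))
      (dF.mono_left Set.sdiff_subset) (fF.subset Set.sdiff_subset) (by omega)
      (fun k hk f hf => hR k (Or.inr hk) f hf.1)
    have h4 := R_add hT H h3 (k := k) (f := f) ?_ ?_ (hK k (Or.inl rfl)) ?_ (hF hf) ?_
      (hR k (Or.inl rfl) f hf)
    · have e1 : insert k (K1 ∪ K0) = insert k K1 ∪ K0 := by rw [Set.insert_union]
      have e2 : insert f (F1 \ {f} ∪ F0) = F1 ∪ F0 := by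
        rw [← Set.insert_union, Set.insert_sdiff_singleton, Set.insert_eq_of_mem hf]
      rw [← e1, ← e2]
      exact h4
    · rintro j (hj | hj)
      · exact hK j (Or.inr hj)
      · exact hK0 j hj
    · exact Set.union_subset (Set.sdiff_subset.trans hF) hF0
    · rintro (hj | hj)
      · exact hk hj
      · exact Set.disjoint_left.1 dK (Or.inl rfl) hj
    · rintro (hj | hj)
      · exact hj.2 rfl
      · exact Set.disjoint_left.1 dF hf hj

theorem R_final (hT : T.IsTree) {r : V} {z : W} {F : Set W}
    (h : R T G dep r {k | T.Adj r k} z F) : InducedMinor T G := by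
  unfold R at h
  rw [KS_univ hT] at h
  exact RM_final h

end models

section shapes

def Leg {W : Type*} (G : SimpleGraph W) (dep : W → ℕ) : ℕ → W → Prop
  | 0, _ => True
  | n + 1, z => ∃ z' ∈ ch G dep z, Leg G dep n z'

def Center {W : Type*} (G : SimpleGraph W) (dep : W → ℕ) (N : ℕ) (z : W) : Prop :=
  ∃ f ∈ ch G dep z, ∃ g ∈ ch G dep z, f ≠ g ∧ Leg G dep (N - 1) f ∧ Leg G dep (N - 1) g

def Star {W : Type*} (G : SimpleGraph W) (dep : W → ℕ) (N : ℕ) (z : W) : Prop :=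
  ∃ F ⊆ ch G dep z, F.Finite ∧ N ≤ F.ncard ∧ ∀ f ∈ F, Center G dep N f

def Ht {W : Type*} (G : SimpleGraph W) (dep : W → ℕ) (N : ℕ) : ℕ → W → Prop
  | 0, z => ∃ f ∈ ch G dep z, ∃ w ∈ ch G dep z, f ≠ w ∧ Star G dep N f ∧ Leg G dep (N - 1) w
  | n + 1, z => ∃ z' ∈ ch G dep z, Ht G dep N n z'

def AnyS {W : Type*} (G : SimpleGraph W) (dep : W → ℕ) (N n : ℕ) (z : W) : Prop :=
  ∃ y ∈ ch G dep z, ∃ w ∈ ch G dep z, y ≠ w ∧ Ht G dep N n y ∧ Leg G dep (N - 1) w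

variable {V W : Type*} {T : SimpleGraph V} {G : SimpleGraph W} {dep : W → ℕ} {N : ℕ}

theorem Leg_le {n : ℕ} : ∀ {m : ℕ} {z : W}, m ≤ n → Leg G dep n z → Leg G dep m z := by
  induction n with
  | zero =>
    intro m z hm _
    obtain rfl : m = 0 := by omega
    trivial
  | succ n ih =>
    intro m z hm h
    cases m with
    | zero => trivial
    | succ m =>
      obtain ⟨y, hy, h⟩ := h
      exact ⟨y, hy, ih (by omega) h⟩

theorem small_set {α : Type*} (S : Set α)
    (h : ∀ a ∈ S, ∀ b ∈ S, ∀ c ∈ S, a ≠ b → a ≠ c → b ≠ c → False) :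
    S = ∅ ∨ (∃ a, S = {a}) ∨ ∃ a b, a ≠ b ∧ S = {a, b} := by
  rcases S.eq_empty_or_nonempty with h0 | ⟨a, ha⟩
  · exact Or.inl h0
  by_cases h1 : ∃ b ∈ S, b ≠ a
  · obtain ⟨b, hb, hba⟩ := h1
    refine Or.inr (Or.inr ⟨a, b, hba.symm, ?_⟩)
    ext c
    constructor
    · intro hc
      by_contra hcc
      have h1 : c ≠ a := fun h => hcc (Or.inl h)
      have h2 : c ≠ b := fun h => hcc (Or.inr h)
      exact h a ha b hb c hc hba.symm h1.symm h2.symm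
    · rintro (rfl | rfl)
      · exact ha
      · exact hb
  · refine Or.inr (Or.inl ⟨a, ?_⟩)
    ext c
    constructor
    · intro hc
      by_contra hca
      exact h1 ⟨c, hc, hca⟩
    · rintro rfl
      exact ha

theorem Br_ncard_lt [Finite V] (hT : T.IsTree) {u v k : V} (huv : T.Adj u v) (hk : k ∈ Kd T u v) :
    (Br T v k).ncard < (Br T u v).ncard := by
  refine Set.ncard_lt_ncard ⟨Br_sub hT huv hk.1 hk.2, fun h => ?_⟩ (Set.toFinite _)
  exact Br_not (h (Br_self huv.ne))

theorem quad_sub {c x y z : V} {X : Set V} (hc : c ∈ X) (hx : x ∈ X) (hy : y ∈ X) (hz : z ∈ X) :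
    ({c, x, y, z} : Set V) ⊆ X := by
  rintro w (rfl | rfl | rfl | rfl) <;> assumption

theorem kid_mem (hT : T.IsTree) {u v k : V} (huv : T.Adj u v) (hk : k ∈ Kd T u v) :
    k ∈ Br T u v := Br_sub hT huv hk.1 hk.2 (Br_self hk.1.ne)

theorem ins_sub (hT : T.IsTree) {u v k : V} (huv : T.Adj u v) (hk : k ∈ Kd T u v) :
    insert v (Br T v k) ⊆ Br T u v :=
  Set.insert_subset (Br_self huv.ne) (Br_sub hT huv hk.1 hk.2)

theorem claw_up (hT : T.IsTree) {u v j k : V} (huv : T.Adj u v) (hj : j ∈ Kd T u v)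
    (hk : k ∈ Kd T u v) (hjk : j ≠ k) :
    IsCl T {v, u, j, k} ∧ ({v, u, j, k} : Set V) ⊆ insert u (Br T u v) :=
  ⟨isCl_mk huv.symm hj.1 hk.1 hj.2.symm hk.2.symm hjk,
    quad_sub (Or.inr (Br_self huv.ne)) (Or.inl rfl) (Or.inr (kid_mem hT huv hj))
      (Or.inr (kid_mem hT huv hk))⟩

theorem claw_dn (hT : T.IsTree) {u v i j k : V} (huv : T.Adj u v) (hi : i ∈ Kd T u v)
    (hj : j ∈ Kd T u v) (hk : k ∈ Kd T u v) (hij : i ≠ j) (hik : i ≠ k) (hjk : j ≠ k) :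
    IsCl T {v, i, j, k} ∧ ({v, i, j, k} : Set V) ⊆ Br T u v :=
  ⟨isCl_mk hi.1 hj.1 hk.1 hij hik hjk,
    quad_sub (Br_self huv.ne) (kid_mem hT huv hi) (kid_mem hT huv hj) (kid_mem hT huv hk)⟩

theorem R_leg [Finite V] (hT : T.IsTree) (H : Host G dep) : ∀ (n : ℕ) {u v : V} {z : W},
    T.Adj u v → ¬ HasClaw T (insert u (Br T u v)) → Leg G dep n z → (Br T u v).ncard ≤ n + 1 →
    R T G dep v (Kd T u v) z (ch G dep z) := by
  intro n
  induction n with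
  | zero =>
    intro u v z huv hc _ hn
    have : Kd T u v = ∅ := by
      rw [Set.eq_empty_iff_forall_notMem]
      intro k hk
      have := Br_ncard_lt hT huv hk
      have h2 : 0 < (Br T v k).ncard := (Set.ncard_pos (Set.toFinite _)).2 ⟨k, Br_self hk.1.ne⟩
      omega
    rw [this]
    exact R_mono (R_base v z) (Set.empty_subset _)
  | succ n ih =>
    intro u v z huv hc hL hn
    have hu : ∀ j ∈ Kd T u v, ∀ k ∈ Kd T u v, j ≠ k → False := fun j hj k hk hjk =>
      hc ⟨_, (claw_up hT huv hj hk hjk).2, (claw_up hT huv hj hk hjk).1⟩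
    rcases small_set (Kd T u v) (fun a ha b hb _ _ hab _ _ => hu a ha b hb hab) with
      h | ⟨k, h⟩ | ⟨a, b, hab, h⟩
    · rw [h]
      exact R_mono (R_base v z) (Set.empty_subset _)
    · have hk : k ∈ Kd T u v := h ▸ rfl
      obtain ⟨y, hy, hL⟩ := hL
      have := Br_ncard_lt hT huv hk
      have h3 := ih (u := v) (v := k) hk.1
        (fun hh => hc (hh.mono ((ins_sub hT huv hk).trans (Set.subset_insert _ _)))) hL (by omega)
      rw [h]
      have := R_add hT H (R_base v z) (by simp) (Set.empty_subset _) hk.1 (by simp) hy (by simp) h3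
      rw [insert_empty_eq] at this
      exact R_mono this (by simpa using hy)
    · exact (hu a (h ▸ Or.inl rfl) b (h ▸ Or.inr rfl) hab).elim

theorem ncard_le_N [Finite V] (hN : Nat.card V ≤ N) (S : Set V) : S.ncard ≤ N :=
  (Set.ncard_le_card S).trans hN

theorem R_leg' [Finite V] (hT : T.IsTree) (H : Host G dep) (hN : Nat.card V ≤ N) {u v : V} {z : W}
    (huv : T.Adj u v) (hc : ¬ HasClaw T (insert u (Br T u v))) (hz : Leg G dep (N - 1) z) :
    R T G dep v (Kd T u v) z (ch G dep z) :=
  R_leg hT H (N - 1) huv hc hz (by have := ncard_le_N hN (Br T u v); omega)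

/-- add one kid to an empty model -/
theorem R_one (hT : T.IsTree) (H : Host G dep) {v k : V} {z f : W} (hk : T.Adj v k)
    (hf : f ∈ ch G dep z) (h : R T G dep k (Kd T v k) f (ch G dep f)) :
    R T G dep v {k} z {f} := by
  have := R_add hT H (R_base v z) (by simp) (Set.empty_subset _) hk (by simp) hf (by simp) h
  rwa [insert_empty_eq, insert_empty_eq] at this

theorem R_two (hT : T.IsTree) (H : Host G dep) {v j k : V} {z f g : W} (hk : T.Adj v k)
    (hj : T.Adj v j) (hjk : j ≠ k) (hf : f ∈ ch G dep z) (hg : g ∈ ch G dep z) (hfg : f ≠ g)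
    (h : R T G dep k (Kd T v k) f (ch G dep f)) (h' : R T G dep j (Kd T v j) g (ch G dep g)) :
    R T G dep v {j, k} z (ch G dep z) := by
  refine R_mono (R_add hT H (R_one hT H hk hf h) ?_ ?_ hj ?_ hg ?_ h') ?_
  · rintro i rfl; exact hk
  · rintro i rfl; exact hf
  · exact hjk
  · exact hfg.symm
  · rintro i (rfl | rfl) <;> assumption

theorem R_center [Finite V] (hT : T.IsTree) (H : Host G dep) (hN : Nat.card V ≤ N) {u v : V} {z : W}
    (huv : T.Adj u v) (hc : ¬ HasClaw T (Br T u v)) (hz : Center G dep N z) :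
    R T G dep v (Kd T u v) z (ch G dep z) := by
  obtain ⟨f, hf, g, hg, hfg, lf, lg⟩ := hz
  have hl : ∀ k ∈ Kd T u v, ∀ f, Leg G dep (N - 1) f → R T G dep k (Kd T v k) f (ch G dep f) :=
    fun k hk f hf => R_leg' hT H hN hk.1 (fun h => hc (h.mono (ins_sub hT huv hk))) hf
  rcases small_set (Kd T u v) (fun a ha b hb c hc' hab hac hbc =>
    hc ⟨_, (claw_dn hT huv ha hb hc' hab hac hbc).2, (claw_dn hT huv ha hb hc' hab hac hbc).1⟩) with
      h | ⟨k, h⟩ | ⟨a, b, hab, h⟩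
  · rw [h]
    exact R_mono (R_base v z) (Set.empty_subset _)
  · have hk : k ∈ Kd T u v := h ▸ rfl
    rw [h]
    exact R_mono (R_one hT H hk.1 hf (hl k hk f lf)) (by simpa using hf)
  · have ha : a ∈ Kd T u v := h ▸ Or.inl rfl
    have hb : b ∈ Kd T u v := h ▸ Or.inr rfl
    rw [h]
    exact R_two hT H hb.1 ha.1 hab hf hg hfg (hl b hb f lf) (hl a ha g lg)

theorem R_star [Finite V] (hT : T.IsTree) (H : Host G dep) (hN : Nat.card V ≤ N) {v : V} {K : Set V}
    {z : W} (hK : ∀ k ∈ K, T.Adj v k) (hc : ∀ k ∈ K, ¬ HasClaw T (Br T v k))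
    (hz : Star G dep N z) : R T G dep v K z (ch G dep z) := by
  obtain ⟨F, hF, fF, cF, hcen⟩ := hz
  have := R_multi hT H (R_base v z) (by simp) (Set.empty_subset _) (Set.toFinite K) hK hF
    (by simp) (by simp) fF ((ncard_le_N hN K).trans cF)
    (fun k hk f hf => R_center hT H hN (hK k hk) (hc k hk) (hcen f hf))
  rw [Set.union_empty, Set.union_empty] at this
  exact R_mono this hF

theorem Ht_lift (H : Host G dep) {v : V} {K : Set V}
    (h0 : ∀ z, Ht G dep N 0 z → R T G dep v K z (ch G dep z)) :
    ∀ (n : ℕ) {z : W}, Ht G dep N n z → R T G dep v K z (ch G dep z) := by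
  intro n
  induction n with
  | zero => exact fun {z} h => h0 z h
  | succ n ih =>
    rintro z ⟨y, hy, h⟩
    exact R_mono (R_contract H (ih h) hy) (by simpa using hy)

theorem Ht_star (H : Host G dep) {v : V} {K : Set V}
    (h0 : ∀ z, Star G dep N z → R T G dep v K z (ch G dep z)) (n : ℕ) {z : W}
    (h : Ht G dep N n z) : R T G dep v K z (ch G dep z) := by
  refine Ht_lift H ?_ n h
  rintro z ⟨f, hf, w, hw, -, hs, -⟩
  exact R_mono (R_contract H (h0 f hs) hf) (by simpa using hf)

/-- kids of `k` are claw-free when each claw of `Br v k` contains `k` -/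
theorem kids_free (hT : T.IsTree) {v k : V} (hk : T.Adj v k) (h : ∀ A ⊆ Br T v k, IsCl T A → k ∈ A) :
    ∀ c ∈ Kd T v k, ¬ HasClaw T (Br T k c) := by
  rintro c hc ⟨A, hA, cA⟩
  exact Br_not (hA (h A (hA.trans (Br_sub hT hk hc.1 hc.2)) cA))

theorem quad_disj {c x y z : V} {A : Set V} (hc : c ∉ A) (hx : x ∉ A) (hy : y ∉ A) (hz : z ∉ A) :
    Disjoint A ({c, x, y, z} : Set V) := by
  rw [Set.disjoint_left]
  rintro w hw (rfl | rfl | rfl | rfl) <;> contradiction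

theorem R_S [Finite V] (hT : T.IsTree) (H : Host G dep) (hN : Nat.card V ≤ N) :
    ∀ (n : ℕ) {u v : V} {z : W}, T.Adj u v → ¬ TwoClaw T (insert u (Br T u v)) →
    Ht G dep N n z → (Br T u v).ncard ≤ n + 4 → R T G dep v (Kd T u v) z (ch G dep z) := by
  intro n
  induction n with
  | zero =>
    intro u v z huv h2 hz hn
    refine Ht_star H (fun z hz => R_star hT H hN (fun k hk => hk.1) ?_ hz) 0 hz
    rintro k hk ⟨A, hA, cA⟩
    have h1 := Br_ncard_lt hT huv hk
    have h3 := Set.ncard_le_ncard hA (Set.toFinite _)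
    have h4 := cA.ncard
    omega
  | succ n ih =>
    intro u v z huv h2 hz hn
    by_cases hcl : ∃ k ∈ Kd T u v, HasClaw T (Br T v k)
    swap
    · push Not at hcl
      exact Ht_star H (fun z hz => R_star hT H hN (fun k hk => hk.1) hcl hz) _ hz
    obtain ⟨k, hk, A, hA, cA⟩ := hcl
    have hAu : A ⊆ insert u (Br T u v) :=
      (hA.trans (Br_sub hT huv hk.1 hk.2)).trans (Set.subset_insert _ _)
    have hvn : v ∉ Br T v k := Br_not
    have hun : u ∉ Br T v k := Br_key hT hk.1 huv.symm hk.2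
    by_cases ho : ∃ j ∈ Kd T u v, j ≠ k
    swap
    · push Not at ho
      have hK : Kd T u v = {k} := by
        ext j
        constructor
        · exact fun h => ho j h
        · rintro rfl; exact hk
      obtain ⟨y, hy, hHt⟩ := hz
      have := Br_ncard_lt hT huv hk
      rw [hK]
      refine R_mono (R_one hT H hk.1 hy (ih hk.1 (fun h => h2 (h.mono ?_)) hHt (by omega)))
        (by simpa using hy)
      exact (ins_sub hT huv hk).trans (Set.subset_insert _ _)
    obtain ⟨j, hj, hjk⟩ := ho
    have hjn : ∀ j ∈ Kd T u v, j ≠ k → j ∉ Br T v k := fun j hj hjk =>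
      Br_key hT hk.1 hj.1 hjk.symm
    have hcont : ∀ B ⊆ Br T v k, IsCl T B → k ∈ B := by
      intro B hB cB
      by_contra hkB
      obtain ⟨c1, c2⟩ := claw_up hT huv hj hk hjk
      exact h2 ⟨B, _, (hB.trans (Br_sub hT huv hk.1 hk.2)).trans (Set.subset_insert _ _), c2, cB,
        c1, quad_disj (fun h => hvn (hB h)) (fun h => hun (hB h))
          (fun h => hjn j hj hjk (hB h)) hkB⟩
    have hthird : ∀ i ∈ Kd T u v, i = j ∨ i = k := by
      intro i hi
      by_contra hcon
      push Not at hcon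
      obtain ⟨c1, c2⟩ := claw_up hT huv hi hj hcon.1
      exact h2 ⟨A, _, hAu, c2, cA, c1, quad_disj (fun h => hvn (hA h)) (fun h => hun (hA h))
        (fun h => hjn i hi hcon.2 (hA h)) (fun h => hjn j hj hjk (hA h))⟩
    have hleg : ¬ HasClaw T (insert v (Br T v j)) := by
      rintro ⟨B, hB, cB⟩
      refine h2 ⟨A, B, hAu, (hB.trans (ins_sub hT huv hj)).trans (Set.subset_insert _ _), cA, cB,
        Set.disjoint_left.2 fun x hx hx' => ?_⟩
      rcases hB hx' with rfl | hx'
      · exact hvn (hA hx)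
      · exact Br_disj hT hk.1 hj.1 hjk.symm (hA hx) hx'
    have hK : Kd T u v = {j, k} := by
      ext i
      constructor
      · exact fun h => hthird i h
      · rintro (rfl | rfl) <;> assumption
    refine Ht_lift H ?_ _ hz
    rintro z ⟨f, hf, w, hw, hfw, hs, hl⟩
    rw [hK]
    exact R_two hT H hk.1 hj.1 hjk hf hw hfw
      (R_star hT H hN (fun c hc => hc.1) (kids_free hT hk.1 hcont) hs)
      (R_leg' hT H hN hj.1 hleg hl)

theorem R_any [Finite V] (hT : T.IsTree) (H : Host G dep) (hN : Nat.card V ≤ N)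
    {n : ℕ} {u v : V} {z : W} (huv : T.Adj u v) (h2 : ¬ TwoClaw T (Br T u v))
    (hz : AnyS G dep N n z) (hn : (Br T u v).ncard ≤ n + 4) :
    R T G dep v (Kd T u v) z (ch G dep z) := by
  obtain ⟨y, hy, w, hw, hyw, hHt, hl⟩ := hz
  by_cases hcl : ∃ k ∈ Kd T u v, HasClaw T (Br T v k)
  swap
  · push Not at hcl
    exact R_mono (R_contract H (Ht_star H (fun z hz => R_star hT H hN (fun k hk => hk.1) hcl hz) _
      hHt) hy) (by simpa using hy)
  obtain ⟨k, hk, A, hA, cA⟩ := hcl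
  have hAu : A ⊆ Br T u v := hA.trans (Br_sub hT huv hk.1 hk.2)
  have hvn : v ∉ Br T v k := Br_not
  have hjn : ∀ j ∈ Kd T u v, j ≠ k → j ∉ Br T v k := fun j hj hjk =>
    Br_key hT hk.1 hj.1 hjk.symm
  have hleg : ∀ j ∈ Kd T u v, j ≠ k → ∀ w, Leg G dep (N - 1) w →
      R T G dep j (Kd T v j) w (ch G dep w) := by
    intro j hj hjk w hl
    refine R_leg' hT H hN hj.1 ?_ hl
    rintro ⟨B, hB, cB⟩
    refine h2 ⟨A, B, hAu, hB.trans (ins_sub hT huv hj), cA, cB,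
      Set.disjoint_left.2 fun x hx hx' => ?_⟩
    rcases hB hx' with rfl | hx'
    · exact hvn (hA hx)
    · exact Br_disj hT hk.1 hj.1 hjk.symm (hA hx) hx'
  have hRS : R T G dep k (Kd T v k) y (ch G dep y) := by
    have := Br_ncard_lt hT huv hk
    exact R_S hT H hN n hk.1 (fun h => h2 (h.mono (ins_sub hT huv hk))) hHt (by omega)
  rcases small_set (Kd T u v \ {k}) (fun a ha b hb c hc hab hac hbc => by
    obtain ⟨c1, c2⟩ := claw_dn hT huv ha.1 hb.1 hc.1 hab hac hbc
    exact h2 ⟨A, _, hAu, c2, cA, c1, quad_disj (fun h => hvn (hA h))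
      (fun h => hjn a ha.1 ha.2 (hA h)) (fun h => hjn b hb.1 hb.2 (hA h))
      (fun h => hjn c hc.1 hc.2 (hA h))⟩) with h | ⟨j, h⟩ | ⟨i, j, hij, h⟩
  · have hK : Kd T u v = {k} := by
      rw [← Set.insert_eq_of_mem hk, ← Set.insert_sdiff_singleton, h, insert_empty_eq]
    rw [hK]
    exact R_mono (R_one hT H hk.1 hy hRS) (by simpa using hy)
  · have hj : j ∈ Kd T u v \ {k} := h ▸ rfl
    have hK : Kd T u v = {j, k} := by
      rw [← Set.insert_eq_of_mem hk, ← Set.insert_sdiff_singleton, h, Set.pair_comm]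
    rw [hK]
    exact R_two hT H hk.1 hj.1.1 hj.2 hy hw hyw hRS (hleg j hj.1 hj.2 w hl)
  · have hi : i ∈ Kd T u v \ {k} := h ▸ Or.inl rfl
    have hj : j ∈ Kd T u v \ {k} := h ▸ Or.inr rfl
    have hK : Kd T u v = {i, j, k} := by
      rw [← Set.insert_eq_of_mem hk, ← Set.insert_sdiff_singleton, h]
      ext x
      simp only [Set.mem_insert_iff, Set.mem_singleton_iff]
      tauto
    have hcont : ∀ B ⊆ Br T v k, IsCl T B → k ∈ B := by
      intro B hB cB
      by_contra hkB
      obtain ⟨c1, c2⟩ := claw_dn hT huv hi.1 hj.1 hk hij hi.2 hj.2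
      exact h2 ⟨B, _, hB.trans (Br_sub hT huv hk.1 hk.2), c2, cB,
        c1, quad_disj (fun h => hvn (hB h)) (fun h => hjn i hi.1 hi.2 (hB h))
          (fun h => hjn j hj.1 hj.2 (hB h)) hkB⟩
    have h3 : R T G dep v {j, k} y (ch G dep y) := by
      refine Ht_lift H ?_ _ hHt
      rintro z ⟨f, hf, w, hw, hfw, hs, hl⟩
      exact R_two hT H hk.1 hj.1.1 hj.2 hf hw hfw
        (R_star hT H hN (fun c hc => hc.1) (kids_free hT hk.1 hcont) hs)
        (hleg j hj.1 hj.2 w hl)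
    rw [hK]
    refine R_mono (R_add hT H (R_contract H h3 hy) ?_ ?_ hi.1.1 ?_ hw ?_
      (hleg i hi.1 hi.2 w hl)) ?_
    · rintro x (rfl | rfl)
      · exact hj.1.1
      · exact hk.1
    · simpa using hy
    · rintro (h | h)
      · exact hij h
      · exact hi.2 h
    · exact hyw.symm
    · rintro x (rfl | rfl) <;> assumption

end shapes

section structureThm

/-- common features of the two host trees -/
structure HB {W : Type*} (G : SimpleGraph W) (dep : W → ℕ) (N : ℕ) (z x y x1 : W)
    (Fc Fx : Set W) : Prop where
  host : Host G dep
  hFc : Fc ⊆ ch G dep z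
  fFc : Fc.Finite
  cFc : N ≤ Fc.ncard
  sFc : ∀ f ∈ Fc, Star G dep N f
  hx : x ∈ ch G dep z
  hy : y ∈ ch G dep z
  hxy : x ≠ y
  xF : x ∉ Fc
  yF : y ∉ Fc
  hFx : Fx ⊆ ch G dep x
  fFx : Fx.Finite
  cFx : N ≤ Fx.ncard
  sFx : ∀ f ∈ Fx, Center G dep N f
  hx1 : x1 ∈ ch G dep x
  x1F : x1 ∉ Fx

variable {V W : Type*} {T : SimpleGraph V} {G : SimpleGraph W} {dep : W → ℕ} {N : ℕ}
  {z x y x1 : W} {Fc Fx : Set W}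

theorem light_kids (hT : T.IsTree) {r k : V} (hk : T.Adj r k) (hl : ¬ Heavy T r k) :
    ∀ c ∈ Kd T r k, ¬ HasClaw T (Br T k c) := by
  intro c hc h
  refine hl (h.mono fun w hw => ⟨Br_sub hT hk hc.1 hc.2 hw, ?_⟩)
  rintro rfl
  exact Br_not hw

theorem finish [Finite V] (hT : T.IsTree) (hN : Nat.card V ≤ N) (B : HB G dep N z x y x1 Fc Fx)
    {r : V} {K0 : Set V} {F0 : Set W} (hR : R T G dep r K0 z F0) (hK0 : ∀ j ∈ K0, T.Adj r j)
    (hF0 : F0 ⊆ {x, y}) (hl : ∀ k, T.Adj r k → k ∉ K0 → ¬ Heavy T r k) : InducedMinor T G := by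
  have hxy : ({x, y} : Set W) ⊆ ch G dep z := by
    rintro w (rfl | rfl)
    · exact B.hx
    · exact B.hy
  have := R_multi hT B.host hR hK0 (hF0.trans hxy) (K1 := {k | T.Adj r k} \ K0) (Set.toFinite _)
    (F1 := Fc) (fun j hj => hj.1) B.hFc Set.disjoint_sdiff_left ?_ B.fFc
    ((ncard_le_N hN _).trans B.cFc) ?_
  · rw [Set.sdiff_union_of_subset (show K0 ⊆ {k | T.Adj r k} from fun j hj => hK0 j hj)] at this
    exact R_final hT this
  · rw [Set.disjoint_left]
    intro f hf hf'
    rcases hF0 hf' with rfl | rfl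
    · exact B.xF hf
    · exact B.yF hf
  · intro k hk f hf
    exact R_star hT B.host hN (fun c hc => hc.1) (light_kids hT hk.1 (hl k hk.1 hk.2)) (B.sFc f hf)

theorem caseI [Finite V] (hT : T.IsTree) (hN : Nat.card V ≤ N) (B : HB G dep N z x y x1 Fc Fx)
    (ha : ¬ ∃ A B C : Set V, NpdConfig T A B C)
    (ax : AnyS G dep N (N - 1) x) (ay : AnyS G dep N (N - 1) y) (r : V)
    (hr : ∀ k, T.Adj r k → ¬ TwoClaw T (Br T r k)) : InducedMinor T G := by
  have hRx : ∀ k, T.Adj r k → R T G dep k (Kd T r k) x (ch G dep x) := fun k hk =>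
    R_any hT B.host hN hk (hr k hk) ax (by have := ncard_le_N hN (Br T r k); omega)
  have hRy : ∀ k, T.Adj r k → R T G dep k (Kd T r k) y (ch G dep y) := fun k hk =>
    R_any hT B.host hN hk (hr k hk) ay (by have := ncard_le_N hN (Br T r k); omega)
  rcases small_set {k | T.Adj r k ∧ Heavy T r k} (fun a h1 b h2 c h3 hab hac hbc => by
    refine npd_of_heavy hT ha r ![a, b, c] ?_ ?_ ?_
    · intro i; fin_cases i
      · exact h1.1
      · exact h2.1
      · exact h3.1
    · intro i j hij
      fin_cases i <;> fin_cases j <;> simp_all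
    · intro i; fin_cases i
      · exact h1.2
      · exact h2.2
      · exact h3.2) with h | ⟨a, h⟩ | ⟨a, b, hab, h⟩
  · refine finish hT hN B (R_base r z) (by simp) (Set.empty_subset _) ?_
    intro k hk _ hh
    have : k ∈ {k | T.Adj r k ∧ Heavy T r k} := ⟨hk, hh⟩
    rw [h] at this
    exact this
  · have h1 : a ∈ {k | T.Adj r k ∧ Heavy T r k} := h ▸ rfl
    refine finish hT hN B (R_one hT B.host h1.1 B.hx (hRx a h1.1)) ?_ ?_ ?_
    · rintro j rfl; exact h1.1
    · rintro j rfl; exact Or.inl rfl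
    · intro k hk hka hh
      have : k ∈ {k | T.Adj r k ∧ Heavy T r k} := ⟨hk, hh⟩
      rw [h] at this
      exact hka this
  · have h1 : a ∈ {k | T.Adj r k ∧ Heavy T r k} := h ▸ Or.inl rfl
    have h2 : b ∈ {k | T.Adj r k ∧ Heavy T r k} := h ▸ Or.inr rfl
    refine finish hT hN B (R_add hT B.host (R_one hT B.host h2.1 B.hx (hRx b h2.1)) ?_ ?_ h1.1 hab
      B.hy B.hxy.symm (hRy a h1.1)) ?_ ?_ ?_
    · rintro j rfl; exact h2.1
    · rintro j rfl; exact B.hx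
    · rintro j (rfl | rfl)
      · exact h1.1
      · exact h2.1
    · rintro j (rfl | rfl)
      · exact Or.inr rfl
      · exact Or.inl rfl
    · intro k hk hka hh
      have : k ∈ {k | T.Adj r k ∧ Heavy T r k} := ⟨hk, hh⟩
      rw [h] at this
      exact hka this

theorem uEmbed [Finite V] (hT : T.IsTree) (hN : Nat.card V ≤ N) (B : HB G dep N z x y x1 Fc Fx)
    {u v : V}
    (h1 : ∀ j ∈ Kd T v u, R T G dep j (Kd T u j) x1 (ch G dep x1))
    (h2 : ∀ j ∈ Kd T v u, ∀ j' ∈ Kd T v u, HasClaw T (Br T u j) → HasClaw T (Br T u j') → j = j') :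
    R T G dep u (Kd T v u) x (ch G dep x) := by
  have key : ∀ K0 F0, R T G dep u K0 x F0 → K0 ⊆ Kd T v u → F0 ⊆ {x1} →
      (∀ j ∈ Kd T v u, j ∉ K0 → ¬ HasClaw T (Br T u j)) →
      R T G dep u (Kd T v u) x (ch G dep x) := by
    intro K0 F0 hR hK hF hc
    have hF' : F0 ⊆ ch G dep x := hF.trans (by simpa using B.hx1)
    have := R_multi hT B.host hR (fun j hj => (hK hj).1) hF' (K1 := Kd T v u \ K0) (Set.toFinite _)
      (F1 := Fx) (fun j hj => hj.1.1) B.hFx Set.disjoint_sdiff_left ?_ B.fFx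
      ((ncard_le_N hN _).trans B.cFx) ?_
    · rw [Set.sdiff_union_of_subset hK] at this
      exact R_mono this (Set.union_subset B.hFx hF')
    · rw [Set.disjoint_left]
      intro f hf hf'
      exact B.x1F ((hF hf') ▸ hf)
    · intro k hk f hf
      exact R_center hT B.host hN hk.1.1 (hc k hk.1 hk.2) (B.sFx f hf)
  by_cases h : ∃ j ∈ Kd T v u, HasClaw T (Br T u j)
  · obtain ⟨j, hj, hc⟩ := h
    refine key {j} {x1} (R_one hT B.host hj.1 B.hx1 (h1 j hj)) (by simpa using hj) subset_rfl ?_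
    intro k hk hkj hck
    exact hkj (h2 k hk j hj hck hc)
  · refine key ∅ ∅ (R_base _ _) (Set.empty_subset _) (Set.empty_subset _) ?_
    intro k hk _ hck
    exact h ⟨k, hk, hck⟩

theorem vEmbed [Finite V] (hT : T.IsTree) (hN : Nat.card V ≤ N) (B : HB G dep N z x y x1 Fc Fx)
    {u v : V} (huv : T.Adj u v) (hu : R T G dep u (Kd T v u) x (ch G dep x))
    (hk : ∀ k ∈ Kd T u v, R T G dep k (Kd T v k) y (ch G dep y))
    (h2 : ∀ j ∈ Kd T u v, ∀ j' ∈ Kd T u v, Heavy T v j → Heavy T v j' → j = j') :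
    InducedMinor T G := by
  have hR := R_one hT B.host huv.symm B.hx hu
  by_cases h : ∃ j ∈ Kd T u v, Heavy T v j
  · obtain ⟨j, hj, hc⟩ := h
    refine finish hT hN B (R_add hT B.host hR ?_ ?_ hj.1 hj.2 B.hy B.hxy.symm (hk j hj)) ?_ ?_ ?_
    · rintro j rfl; exact huv.symm
    · rintro j rfl; exact B.hx
    · rintro i (rfl | rfl)
      · exact hj.1
      · exact huv.symm
    · rintro i (rfl | rfl)
      · exact Or.inr rfl
      · exact Or.inl rfl
    · intro k hk hkn hh
      have hku : k ≠ u := fun h => hkn (Or.inr h)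
      exact hkn (Or.inl (h2 k ⟨hk, hku⟩ j hj hh hc))
  · refine finish hT hN B hR ?_ ?_ ?_
    · rintro j rfl; exact huv.symm
    · rintro j rfl; exact Or.inl rfl
    · intro k hk hkn hh
      exact h ⟨k, ⟨hk, hkn⟩, hh⟩

theorem heavy_of_two {m k : V} (h : TwoClaw T (Br T m k)) : Heavy T m k := by
  obtain ⟨A, B, hA, hB, cA, cB, hd⟩ := h
  by_cases hk : k ∈ A
  · refine ⟨B, fun w hw => ⟨hB hw, ?_⟩, cB⟩
    rintro rfl
    exact Set.disjoint_left.1 hd hk hw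
  · refine ⟨A, fun w hw => ⟨hA hw, ?_⟩, cA⟩
    rintro rfl
    exact hk hw

theorem heavy_unique (hT : T.IsTree) (ha : ¬ ∃ A B C : Set V, NpdConfig T A B C) {u v : V}
    (huv : T.Adj u v) (h : Heavy T v u) :
    ∀ j ∈ Kd T u v, ∀ j' ∈ Kd T u v, Heavy T v j → Heavy T v j' → j = j' := by
  intro j hj j' hj' h1 h2
  by_contra hne
  have := hj.2
  have := hj'.2
  refine npd_of_heavy hT ha v ![u, j, j'] ?_ ?_ ?_
  · intro i; fin_cases i
    · exact huv.symm
    · exact hj.1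
    · exact hj'.1
  · intro i j hij
    fin_cases i <;> fin_cases j <;> simp_all
  · intro i; fin_cases i
    · exact h
    · exact h1
    · exact h2

theorem exists_edge [Finite V] [Nonempty V] (hT : T.IsTree)
    (h : ∀ u, ∃ v, T.Adj u v ∧ TwoClaw T (Br T u v)) :
    ∃ u v, T.Adj u v ∧ TwoClaw T (Br T u v) ∧ TwoClaw T (Br T v u) := by
  choose g hg hg2 using h
  obtain ⟨u, hu⟩ := Finite.exists_min (fun u => (Br T u (g u)).ncard)
  refine ⟨u, g u, hg u, hg2 u, ?_⟩
  by_cases hw : g (g u) = u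
  · have := hg2 (g u)
    rwa [hw] at this
  · have := Br_ncard_lt hT (hg u) (k := g (g u)) ⟨hg _, hw⟩
    have := hu (g u)
    omega

theorem caseII [Finite V] {W' : Type*} {G' : SimpleGraph W'} {dep' : W' → ℕ} {z' x' y' x1' : W'}
    {Fc' Fx' : Set W'} (hT : T.IsTree) (hN : Nat.card V ≤ N)
    (B2 : HB G dep N z x y x1 Fc Fx) (B3 : HB G' dep' N z' x' y' x1' Fc' Fx')
    (ha : ¬ ∃ A B C : Set V, NpdConfig T A B C)
    (hb : ¬ ∃ A B C D : Set V, NdsConfig T A B C D)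
    (a2 : AnyS G dep N (N - 2) x1) (t2 : Ht G dep N N y)
    (a3 : AnyS G' dep' N (N - 1) y') (t3 : Ht G' dep' N (N - 1) x1')
    {u v : V} (huv : T.Adj u v) (h1 : TwoClaw T (Br T u v)) (h2 : TwoClaw T (Br T v u))
    (hone : ∀ j ∈ Kd T v u, ∀ j' ∈ Kd T v u, HasClaw T (Br T u j) → HasClaw T (Br T u j') →
      j = j') : InducedMinor T G ∨ InducedMinor T G' := by
  have nu : ∀ j ∈ Kd T v u, ¬ TwoClaw T (Br T u j) := fun j hj h =>
    two_unique hT hb huv hj.1 hj.2 h1 h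
  have nv : ∀ j ∈ Kd T u v, ¬ TwoClaw T (Br T v j) := fun j hj h =>
    two_unique hT hb huv.symm hj.1 hj.2 h2 h
  have hu := heavy_unique hT ha huv (heavy_of_two h2)
  have sz : ∀ a b, (Br T a b).ncard ≤ N := fun a b => ncard_le_N hN _
  by_cases h : ∃ j ∈ Kd T v u, TwoClaw T (insert u (Br T u j))
  · obtain ⟨j, hj, hj2⟩ := h
    have hS : ∀ k ∈ Kd T u v, ¬ TwoClaw T (insert v (Br T v k)) := fun k hk hk2 =>
      ll hT hb huv hj hk (nu j hj) hj2 (nv k hk) hk2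
    refine Or.inl (vEmbed hT hN B2 huv (uEmbed hT hN B2 ?_ hone) ?_ hu)
    · intro i hi
      exact R_any hT B2.host hN hi.1 (nu i hi) a2 (by have := sz u i; omega)
    · intro k hk
      exact R_S hT B2.host hN N hk.1 (hS k hk) t2 (by have := sz v k; omega)
  · push Not at h
    refine Or.inr (vEmbed hT hN B3 huv (uEmbed hT hN B3 ?_ hone) ?_ hu)
    · intro i hi
      exact R_S hT B3.host hN _ hi.1 (h i hi) t3 (by have := sz u i; omega)
    · intro k hk
      exact R_any hT B3.host hN hk.1 (nv k hk) a3 (by have := sz v k; omega)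

end structureThm

section hosts

abbrev vr {ℓ : ℕ} : TVert ℓ := Sum.inl ()
abbrev vc {ℓ : ℕ} (i : Fin ℓ) : TVert ℓ := Sum.inr (Sum.inl i)
abbrev vp {ℓ : ℕ} (p : Fin 2) (i : Fin (ℓ + 2)) : TVert ℓ := Sum.inr (Sum.inr (Sum.inl (p, i)))
abbrev va {ℓ : ℕ} (p : Fin 3) (i : Fin ℓ) : TVert ℓ :=
  Sum.inr (Sum.inr (Sum.inr (Sum.inl (p, i))))
abbrev vt {ℓ : ℕ} (s : Fin (ℓ + 3)) (j : Fin ℓ) (i : Fin (2 * ℓ + 1)) : TVert ℓ :=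
  Sum.inr (Sum.inr (Sum.inr (Sum.inr (s, j, i))))

def hd0 (ℓ : ℕ) : TVert ℓ → ℕ
  | Sum.inl _ => 0
  | Sum.inr (Sum.inl _) => 1
  | Sum.inr (Sum.inr (Sum.inl p)) => (p.2 : ℕ) + 1
  | Sum.inr (Sum.inr (Sum.inr _)) => 0

def hdep (ℓ : ℕ) (three : Bool) : TVert ℓ → ℕ
  | Sum.inl _ => 0
  | Sum.inr (Sum.inl _) => 1
  | Sum.inr (Sum.inr (Sum.inl p)) => (p.2 : ℕ) + 1
  | Sum.inr (Sum.inr (Sum.inr (Sum.inl p))) => hd0 ℓ (attachPt ℓ three p.1) + 1 + (p.2 : ℕ)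
  | Sum.inr (Sum.inr (Sum.inr (Sum.inr p))) =>
      hd0 ℓ (glueSite ℓ p.1) + 1 + (((p.2.2 : ℕ) - ℓ) + (ℓ - (p.2.2 : ℕ)))

def hpar (ℓ : ℕ) (three : Bool) : TVert ℓ → TVert ℓ
  | Sum.inl _ => vr
  | Sum.inr (Sum.inl _) => vr
  | Sum.inr (Sum.inr (Sum.inl p)) =>
      if (p.2 : ℕ) = 0 then vr else vp p.1 ⟨(p.2 : ℕ) - 1, by have := p.2.isLt; omega⟩
  | Sum.inr (Sum.inr (Sum.inr (Sum.inl p))) =>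
      if (p.2 : ℕ) = 0 then attachPt ℓ three p.1
      else va p.1 ⟨(p.2 : ℕ) - 1, by have := p.2.isLt; omega⟩
  | Sum.inr (Sum.inr (Sum.inr (Sum.inr p))) =>
      if (p.2.2 : ℕ) = ℓ then glueSite ℓ p.1
      else if h : (p.2.2 : ℕ) < ℓ then vt p.1 p.2.1 ⟨(p.2.2 : ℕ) + 1, by omega⟩
      else vt p.1 p.2.1 ⟨(p.2.2 : ℕ) - 1, by have := p.2.2.isLt; omega⟩

theorem attach_dep (ℓ : ℕ) (three : Bool) (p : Fin 3) :
    hdep ℓ three (attachPt ℓ three p) = hd0 ℓ (attachPt ℓ three p) := by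
  unfold attachPt
  split_ifs <;> rfl

theorem glue_dep (ℓ : ℕ) (three : Bool) (p : Fin (ℓ + 3)) :
    hdep ℓ three (glueSite ℓ p) = hd0 ℓ (glueSite ℓ p) := by
  unfold glueSite
  split_ifs <;> rfl

theorem TAdj_at {ℓ : ℕ} {three : Bool} {a : TVert ℓ} {p : Fin 3} {i : Fin ℓ}
    (h : TAdj ℓ three a (va p i)) :
    (∃ j, a = va p j ∧ (j : ℕ) + 1 = i) ∨ ((i : ℕ) = 0 ∧ a = attachPt ℓ three p) := by
  rcases a with _ | _ | _ | ⟨q, j⟩ | _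
  · exact Or.inr h
  · exact Or.inr h
  · exact Or.inr h
  · obtain ⟨h1, h2⟩ := h
    simp only at h1 h2
    subst h1
    exact Or.inl ⟨j, rfl, h2⟩
  · exact Or.inr h

theorem TAdj_tt {ℓ : ℕ} {three : Bool} {a : TVert ℓ} {s : Fin (ℓ + 3)} {j : Fin ℓ}
    {i : Fin (2 * ℓ + 1)} (h : TAdj ℓ three a (vt s j i)) :
    (∃ i', a = vt s j i' ∧ (i' : ℕ) + 1 = i) ∨ ((i : ℕ) = ℓ ∧ a = glueSite ℓ s) := by
  rcases a with _ | _ | _ | _ | ⟨s', j', i'⟩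
  · exact Or.inr h
  · exact Or.inr h
  · exact Or.inr h
  · exact Or.inr h
  · obtain ⟨h1, h2, h3⟩ := h
    simp only at h1 h2 h3
    subst h1 h2
    exact Or.inl ⟨i', rfl, h3⟩

theorem TAdj_par {ℓ : ℕ} {three : Bool} {a b : TVert ℓ} (h : TAdj ℓ three a b) :
    (hpar ℓ three b = a ∧ hdep ℓ three a < hdep ℓ three b) ∨
    (hpar ℓ three a = b ∧ hdep ℓ three b < hdep ℓ three a) := by
  rcases b with _ | i | ⟨p, i⟩ | ⟨p, i⟩ | ⟨s, j, i⟩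
  · rcases a with _ | _ | _ | _ | _ <;> exact h.elim
  · rcases a with _ | _ | _ | _ | _
    · exact Or.inl ⟨rfl, by simp [hdep]⟩
    all_goals exact h.elim
  · rcases a with _ | _ | ⟨q, j⟩ | _ | _
    · left
      have h : (i : ℕ) = 0 := h
      exact ⟨by simp [hpar, h], by simp [hdep]⟩
    · exact h.elim
    · obtain ⟨h1, h2⟩ := h
      simp only at h1 h2
      subst h1
      left
      refine ⟨?_, by simp only [hdep]; omega⟩
      simp only [hpar]
      rw [if_neg (by omega)]
      congr 4
      all_goals first | omega | (apply Fin.ext; omega) | (apply Fin.ext; simp only; omega)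
    · exact h.elim
    · exact h.elim
  · left
    rcases TAdj_at h with ⟨j, rfl, hj⟩ | ⟨h1, rfl⟩
    · refine ⟨?_, by simp only [hdep]; omega⟩
      simp only [hpar]
      rw [if_neg (by omega)]
      congr 5
      all_goals first | omega | (apply Fin.ext; omega) | (apply Fin.ext; simp only; omega)
    · refine ⟨by simp only [hpar]; rw [if_pos h1], ?_⟩
      rw [attach_dep]
      simp only [hdep]; omega
  · rcases TAdj_tt h with ⟨i', rfl, hj⟩ | ⟨h1, rfl⟩
    · by_cases hi : (i' : ℕ) < ℓ
      · right
        refine ⟨?_, by simp only [hdep]; omega⟩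
        simp only [hpar]
        rw [if_neg (by omega), dif_pos hi]
        congr 6
        all_goals first | omega | (apply Fin.ext; omega) | (apply Fin.ext; simp only; omega)
      · left
        refine ⟨?_, by simp only [hdep]; omega⟩
        simp only [hpar]
        rw [if_neg (by omega), dif_neg (by omega)]
        congr 6
        all_goals first | omega | (apply Fin.ext; omega) | (apply Fin.ext; simp only; omega)
    · left
      refine ⟨by simp only [hpar]; rw [if_pos h1], ?_⟩
      rw [glue_dep]
      simp only [hdep]; omega

/-- the two host trees at once -/
def TG (ℓ : ℕ) (three : Bool) : SimpleGraph (TVert ℓ) := SimpleGraph.fromRel (TAdj ℓ three)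

variable {ℓ : ℕ} {three : Bool}

theorem TG_par {a b : TVert ℓ} (h : (TG ℓ three).Adj a b) :
    (hpar ℓ three b = a ∧ hdep ℓ three a < hdep ℓ three b) ∨
    (hpar ℓ three a = b ∧ hdep ℓ three b < hdep ℓ three a) := by
  rw [TG, SimpleGraph.fromRel_adj] at h
  rcases h.2 with h | h
  · exact TAdj_par h
  · exact (TAdj_par h).symm

theorem TG_host : Host (TG ℓ three) (hdep ℓ three) where
  h1 a b h := by rcases TG_par h with h | h <;> omega
  h2 a b b' h h' hl hl' := by
    have e1 : hpar ℓ three a = b := by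
      rcases TG_par h with h | h
      · omega
      · exact h.1
    have e2 : hpar ℓ three a = b' := by
      rcases TG_par h' with h | h
      · omega
      · exact h.1
    exact e1.symm.trans e2

theorem ch_of {a b : TVert ℓ} (h : TAdj ℓ three a b ∨ TAdj ℓ three b a)
    (hd : hdep ℓ three a < hdep ℓ three b) : b ∈ ch (TG ℓ three) (hdep ℓ three) a := by
  refine ⟨?_, hd⟩
  rw [TG, SimpleGraph.fromRel_adj]
  refine ⟨?_, h⟩
  rintro rfl
  exact lt_irrefl _ hd

theorem ch_rc (i : Fin ℓ) : vc i ∈ ch (TG ℓ three) (hdep ℓ three) vr :=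
  ch_of (Or.inl trivial) (by simp [hdep])

theorem ch_rp (p : Fin 2) : vp p ⟨0, by omega⟩ ∈ ch (TG ℓ three) (hdep ℓ three) vr :=
  ch_of (Or.inl rfl) (by simp [hdep])

theorem ch_pp (p : Fin 2) (i : ℕ) (hi : i + 1 < ℓ + 2) :
    vp p ⟨i + 1, hi⟩ ∈ ch (TG ℓ three) (hdep ℓ three) (vp p ⟨i, by omega⟩) :=
  ch_of (Or.inl ⟨rfl, rfl⟩) (by simp [hdep])

theorem ch_aa (p : Fin 3) (i : ℕ) (hi : i + 1 < ℓ) :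
    va p ⟨i + 1, hi⟩ ∈ ch (TG ℓ three) (hdep ℓ three) (va p ⟨i, by omega⟩) :=
  ch_of (Or.inl ⟨rfl, rfl⟩) (by simp [hdep])

theorem ch_att (p : Fin 3) (h : 0 < ℓ) :
    va p ⟨0, h⟩ ∈ ch (TG ℓ three) (hdep ℓ three) (attachPt ℓ three p) := by
  refine ch_of (Or.inl ?_) ?_
  · have : ∀ x : TVert ℓ, x = attachPt ℓ three p → TAdj ℓ three x (va p ⟨0, h⟩) := by
      rintro (_ | _ | _ | _ | _) hx
      · exact ⟨rfl, hx⟩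
      · exact ⟨rfl, hx⟩
      · exact ⟨rfl, hx⟩
      · unfold attachPt at hx; split_ifs at hx <;> simp at hx
      · unfold attachPt at hx; split_ifs at hx <;> simp at hx
    exact this _ rfl
  · rw [attach_dep]
    simp only [hdep]; omega

theorem ch_glue (s : Fin (ℓ + 3)) (j : Fin ℓ) :
    vt s j ⟨ℓ, by omega⟩ ∈ ch (TG ℓ three) (hdep ℓ three) (glueSite ℓ s) := by
  refine ch_of (Or.inl ?_) ?_
  · have : ∀ x : TVert ℓ, x = glueSite ℓ s → TAdj ℓ three x (vt s j ⟨ℓ, by omega⟩) := by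
      rintro (_ | _ | _ | _ | _) hx
      · exact ⟨rfl, hx⟩
      · exact ⟨rfl, hx⟩
      · exact ⟨rfl, hx⟩
      · exact ⟨rfl, hx⟩
      · unfold glueSite at hx; split_ifs at hx <;> simp at hx
    exact this _ rfl
  · rw [glue_dep]
    simp only [hdep]; omega

theorem ch_tr (s : Fin (ℓ + 3)) (j : Fin ℓ) (i : ℕ) (hi : i + 1 < 2 * ℓ + 1) (h : ℓ ≤ i) :
    vt s j ⟨i + 1, hi⟩ ∈ ch (TG ℓ three) (hdep ℓ three) (vt s j ⟨i, by omega⟩) :=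
  ch_of (Or.inl ⟨rfl, rfl, rfl⟩) (by simp only [hdep]; omega)

theorem ch_tl (s : Fin (ℓ + 3)) (j : Fin ℓ) (i : ℕ) (hi : i + 1 < 2 * ℓ + 1) (h : i + 1 ≤ ℓ) :
    vt s j ⟨i, by omega⟩ ∈ ch (TG ℓ three) (hdep ℓ three) (vt s j ⟨i + 1, hi⟩) :=
  ch_of (Or.inr ⟨rfl, rfl, rfl⟩) (by simp only [hdep]; omega)

theorem leg_a (p : Fin 3) : ∀ (n i : ℕ) (hi : i < ℓ), i + n + 1 = ℓ →
    Leg (TG ℓ three) (hdep ℓ three) n (va p ⟨i, hi⟩) := by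
  intro n
  induction n with
  | zero => intros; trivial
  | succ n ih =>
    intro i hi h
    exact ⟨_, ch_aa p i (by omega), ih (i + 1) (by omega) (by omega)⟩

theorem leg_r (s : Fin (ℓ + 3)) (j : Fin ℓ) : ∀ (n i : ℕ) (hi : i < 2 * ℓ + 1), ℓ ≤ i →
    i + n = 2 * ℓ → Leg (TG ℓ three) (hdep ℓ three) n (vt s j ⟨i, hi⟩) := by
  intro n
  induction n with
  | zero => intros; trivial
  | succ n ih =>
    intro i hi h1 h
    exact ⟨_, ch_tr s j i (by omega) h1, ih (i + 1) (by omega) (by omega) (by omega)⟩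

theorem leg_l (s : Fin (ℓ + 3)) (j : Fin ℓ) : ∀ (n : ℕ) (hi : n < 2 * ℓ + 1), n ≤ ℓ →
    Leg (TG ℓ three) (hdep ℓ three) n (vt s j ⟨n, hi⟩) := by
  intro n
  induction n with
  | zero => intros; trivial
  | succ n ih =>
    intro hi h1
    exact ⟨_, ch_tl s j n hi h1, ih (by omega) (by omega)⟩

theorem center_t (s : Fin (ℓ + 3)) (j : Fin ℓ) :
    Center (TG ℓ three) (hdep ℓ three) ℓ (vt s j ⟨ℓ, by omega⟩) := by
  have hl : 0 < ℓ := by have := j.isLt; omega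
  obtain ⟨m, rfl⟩ : ∃ m, ℓ = m + 1 := ⟨ℓ - 1, by omega⟩
  refine ⟨_, ch_tr s j (m + 1) (by omega) le_rfl, _, ch_tl s j m (by omega) le_rfl, ?_, ?_, ?_⟩
  · simp; omega
  · exact leg_r s j _ _ (by omega) (by omega) (by omega)
  · exact leg_l s j m (by omega) (by omega)

def tSet (ℓ : ℕ) (s : Fin (ℓ + 3)) : Set (TVert ℓ) :=
  Set.range (fun j : Fin ℓ => (vt s j ⟨ℓ, by omega⟩ : TVert ℓ))

theorem tSet_card (s : Fin (ℓ + 3)) : (tSet ℓ s).ncard = ℓ := by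
  unfold tSet
  rw [← Set.image_univ, Set.ncard_image_of_injective, Set.ncard_univ, Nat.card_eq_fintype_card,
    Fintype.card_fin]
  intro a b h
  simpa using h

theorem cSet_card : (Set.range (fun j : Fin ℓ => (vc j : TVert ℓ))).ncard = ℓ := by
  rw [← Set.image_univ, Set.ncard_image_of_injective, Set.ncard_univ, Nat.card_eq_fintype_card,
    Fintype.card_fin]
  intro a b h
  simpa using h

theorem star_g (s : Fin (ℓ + 3)) : Star (TG ℓ three) (hdep ℓ three) ℓ (glueSite ℓ s) := by
  refine ⟨tSet ℓ s, ?_, Set.finite_range _, (tSet_card s).ge, ?_⟩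
  · rintro _ ⟨j, rfl⟩
    exact ch_glue s j
  · rintro _ ⟨j, rfl⟩
    exact center_t s j

theorem ht_p (hl : 0 < ℓ) (p : Fin 2) : ∀ (n i : ℕ) (hi : i < ℓ + 2), i + n = ℓ →
    Ht (TG ℓ three) (hdep ℓ three) ℓ n (vp p ⟨i, hi⟩) := by
  intro n
  induction n with
  | zero =>
    intro i hi h
    obtain rfl : i = ℓ := by omega
    have e1 : glueSite i ⟨(p : ℕ) + 1, by omega⟩ = vp p ⟨i + 1, by omega⟩ := by
      fin_cases p <;> simp [glueSite]
    have e2 : attachPt i three ⟨(p : ℕ), by omega⟩ = vp p ⟨i, hi⟩ := by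
      fin_cases p <;> simp [attachPt]
    refine ⟨_, ch_pp p i (by omega), va ⟨(p : ℕ), by omega⟩ ⟨0, hl⟩, ?_, by simp, ?_, ?_⟩
    · have := ch_att (three := three) (⟨(p : ℕ), by omega⟩ : Fin 3) hl
      rwa [e2] at this
    · have := star_g (three := three) (⟨(p : ℕ) + 1, by omega⟩ : Fin (i + 3))
      rwa [e1] at this
    · exact leg_a _ _ _ hl (by omega)
  | succ n ih =>
    intro i hi h
    exact ⟨_, ch_pp p i (by omega), ih (i + 1) (by omega) (by omega)⟩

theorem TG_HB (hl : 0 < ℓ) : HB (TG ℓ three) (hdep ℓ three) ℓ vr (vp 0 ⟨0, by omega⟩)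
    (vp 1 ⟨0, by omega⟩) (vp 0 ⟨1, by omega⟩) (Set.range fun j : Fin ℓ => vc j) (tSet ℓ 0) where
  host := TG_host
  hFc := by rintro _ ⟨j, rfl⟩; exact ch_rc j
  fFc := Set.finite_range _
  cFc := cSet_card.ge
  sFc := by
    rintro _ ⟨j, rfl⟩
    have e : glueSite ℓ ⟨(j : ℕ) + 3, by omega⟩ = vc j := by simp [glueSite]
    have := star_g (three := three) (⟨(j : ℕ) + 3, by omega⟩ : Fin (ℓ + 3))
    rwa [e] at this
  hx := ch_rp 0
  hy := ch_rp 1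
  hxy := by simp
  xF := by rintro ⟨j, h⟩; simp at h
  yF := by rintro ⟨j, h⟩; simp at h
  hFx := by
    rintro _ ⟨j, rfl⟩
    exact ch_glue (three := three) 0 j
  fFx := Set.finite_range _
  cFx := (tSet_card 0).ge
  sFx := by rintro _ ⟨j, rfl⟩; exact center_t 0 j
  hx1 := ch_pp 0 0 (by omega)
  x1F := by rintro ⟨j, h⟩; simp at h

theorem any_x3 (hl : 0 < ℓ) :
    AnyS (TG ℓ three) (hdep ℓ three) ℓ (ℓ - 1) (vp 0 ⟨0, by omega⟩) := by
  refine ⟨_, ch_pp 0 0 (by omega), _, ch_glue (three := three) 0 ⟨0, hl⟩, ?_,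
    ht_p hl 0 _ _ _ (by omega), Leg_le (Nat.sub_le _ _) (leg_l 0 ⟨0, hl⟩ ℓ (by omega) le_rfl)⟩
  simp

theorem any_y3 (hl : 0 < ℓ) :
    AnyS (TG ℓ true) (hdep ℓ true) ℓ (ℓ - 1) (vp 1 ⟨0, by omega⟩) := by
  refine ⟨_, ch_pp 1 0 (by omega), _, ch_att (three := true) 2 hl, ?_,
    ht_p hl 1 _ _ _ (by omega), leg_a _ _ _ hl (by omega)⟩
  simp

theorem any_x2 (hl : 2 ≤ ℓ) :
    AnyS (TG ℓ false) (hdep ℓ false) ℓ (ℓ - 2) (vp 0 ⟨1, by omega⟩) := by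
  refine ⟨_, ch_pp 0 1 (by omega), _, ch_att (three := false) 2 (by omega), ?_,
    ht_p (by omega) 0 _ _ _ (by omega), leg_a _ _ _ (by omega) (by omega)⟩
  simp

end hosts

theorem final_thm (V : Type) [Fintype V] (T : SimpleGraph V) (hT : T.IsTree)
    (ha : ¬ ∃ A B C : Set V, NpdConfig T A B C)
    (hb : ¬ ∃ A B C D : Set V, NdsConfig T A B C D) :
    InducedMinor T (T2Graph (Fintype.card V)) ∨
      InducedMinor T (T3Graph (Fintype.card V)) := by
  have : Nonempty V := hT.connected.nonempty
  have hl : 0 < Fintype.card V := Fintype.card_pos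
  have hN : Nat.card V ≤ Fintype.card V := Nat.card_eq_fintype_card.le
  by_cases h : ∀ u, ∃ v, T.Adj u v ∧ TwoClaw T (Br T u v)
  · obtain ⟨u, v, huv, h1, h2⟩ := exists_edge hT h
    have hl2 : 2 ≤ Fintype.card V := Fintype.one_lt_card_iff.2 ⟨u, v, huv.ne⟩
    have hB2 := TG_HB (three := false) hl
    have hB3 := TG_HB (three := true) hl
    by_cases hone : ∀ j ∈ Kd T v u, ∀ j' ∈ Kd T v u,
        HasClaw T (Br T u j) → HasClaw T (Br T u j') → j = j'
    · exact caseII hT hN hB2 hB3 ha hb (any_x2 hl2) (ht_p hl 1 _ _ _ (by omega)) (any_y3 hl)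
        (ht_p hl 0 _ _ _ (by omega)) huv h1 h2 hone
    · refine caseII hT hN hB2 hB3 ha hb (any_x2 hl2) (ht_p hl 1 _ _ _ (by omega)) (any_y3 hl)
        (ht_p hl 0 _ _ _ (by omega)) huv.symm h2 h1 ?_
      push Not at hone
      obtain ⟨j, hj, j', hj', c1, c2, hne⟩ := hone
      intro k hk k' hk' c3 c4
      by_contra hkk
      exact pp hT hb huv hj hj' hne hk hk' hkk c1 c2 c3 c4
  · push Not at h
    obtain ⟨r, hr⟩ := h
    exact Or.inr (caseI hT hN (TG_HB (three := true) hl) ha (any_x3 hl) (any_y3 hl) r hr)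

theorem statement8 (V : Type) [Fintype V] (T : SimpleGraph V) (hT : T.IsTree)
    (ha : ¬ ∃ A B C : Set V, NpdConfig T A B C)
    (hb : ¬ ∃ A B C D : Set V, NdsConfig T A B C D) :
    InducedMinor T (T2Graph (Fintype.card V)) ∨
      InducedMinor T (T3Graph (Fintype.card V)) := by
  exact final_thm V T hT ha hb

end Paper
end

section
/- Let T be a finite tree rooted at an arbitrary vertex such that there do not exist four pairwise disjoint sets A, B, C, D each inducing a claw in T, an A–B path P with V(P) disjoint from N_T[C ∪ D], a C–D path Q with V(Q) disjoint from N_T[A ∪ B], at most one edge between A ∪ B and C ∪ D, this edge (if it exists) joining a leaf of one of the claws A, B to a leaf of one of the claws C, D. Let X be the set of vertices x of T such that the subtree of T rooted at x contains a claw but no subtree rooted at a strict descendant of x contains a claw. Then the set {lca(x, y) : x, y ∈ X, x ≠ y} of least common ancestors of distinct pairs of X has at most two elements, and any two of its elements are comparable in the ancestor–descendant order. -/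
open SimpleGraph

namespace Paper

variable {V W : Type*}

section Helpers

variable {T : SimpleGraph V} {r : V}

theorem anc_mem (hT : T.IsTree) {u v : V} (h : IsAncestor T r u v) {p : T.Walk r v}
    (hp : p.IsPath) : u ∈ p.support := by
  obtain ⟨q, hq, hu⟩ := h
  have : (⟨p, hp⟩ : T.Path r v) = ⟨q, hq⟩ := hT.isAcyclic.path_unique _ _
  have h2 : p = q := congrArg Subtype.val this
  rw [h2]; exact hu

theorem ex_path (hT : T.IsTree) (v : V) : ∃ p : T.Walk r v, p.IsPath := by
  obtain ⟨p, hp⟩ := hT.connected.exists_isPath r v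
  exact ⟨p, hp⟩

theorem anc_refl (hT : T.IsTree) (v : V) : IsAncestor T r v v := by
  obtain ⟨p, hp⟩ := ex_path (r := r) hT v
  exact ⟨p, hp, p.end_mem_support⟩

theorem anc_trans (hT : T.IsTree) {u v w : V} (h : IsAncestor T r u v)
    (h' : IsAncestor T r v w) : IsAncestor T r u w := by
  classical
  obtain ⟨p, hp, hv⟩ := h'
  exact ⟨p, hp, p.support_takeUntil_subset_support hv (anc_mem hT h (hp.takeUntil hv))⟩

theorem anc_antisymm (hT : T.IsTree) {u v : V} (h : IsAncestor T r u v)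
    (h' : IsAncestor T r v u) : u = v := by
  classical
  by_contra hne
  obtain ⟨p, hp, hu⟩ := h
  exact Walk.endpoint_notMem_support_takeUntil hp hu (Ne.symm hne)
    (anc_mem hT h' (hp.takeUntil hu))

/-- part of a path below `u`. -/
theorem anc_down {u w : V} (h : IsAncestor T r u w) :
    ∃ q : T.Walk u w, ∀ y ∈ q.support, IsAncestor T r u y := by
  classical
  obtain ⟨p, hp, hu⟩ := h
  refine ⟨p.dropUntil u hu, fun y hy => ?_⟩
  refine ⟨(p.takeUntil u hu).append ((p.dropUntil u hu).takeUntil y hy), ?_, ?_⟩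
  · have h1 : ((p.takeUntil u hu).append ((p.dropUntil u hu).takeUntil y hy)).append
        ((p.dropUntil u hu).dropUntil y hy) = p := by
      rw [← Walk.append_assoc, Walk.take_spec, Walk.take_spec]
    rw [← h1] at hp
    exact hp.of_append_left
  · rw [Walk.mem_support_append_iff]
    exact Or.inl (Walk.end_mem_support _)

theorem anc_comp {u v w : V} (h : IsAncestor T r u w) (h' : IsAncestor T r v w)
    (hT : T.IsTree) : IsAncestor T r u v ∨ IsAncestor T r v u := by
  classical
  obtain ⟨p, hp, hu⟩ := id h
  have hv := anc_mem hT h' hp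
  rw [← p.take_spec hu, Walk.mem_support_append_iff] at hv
  rcases hv with hv | hv
  · exact Or.inr ⟨_, hp.takeUntil hu, hv⟩
  · left
    refine ⟨(p.takeUntil u hu).append ((p.dropUntil u hu).takeUntil v hv), ?_, ?_⟩
    · have h1 : ((p.takeUntil u hu).append ((p.dropUntil u hu).takeUntil v hv)).append
          ((p.dropUntil u hu).dropUntil v hv) = p := by
        rw [← Walk.append_assoc, Walk.take_spec, Walk.take_spec]
      rw [← h1] at hp
      exact hp.of_append_left
    · rw [Walk.mem_support_append_iff]
      exact Or.inl (Walk.end_mem_support _)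

theorem anc_edge (hT : T.IsTree) {s u v : V} (huv : T.Adj u v) (h : IsAncestor T r s u)
    (h' : ¬ IsAncestor T r s v) : u = s ∧ IsAncestor T r v s := by
  obtain ⟨q, hq⟩ := ex_path (r := r) hT v
  by_cases hu : u ∈ q.support
  · exact absurd (anc_trans hT h ⟨q, hq, hu⟩) h'
  · have hc : (q.concat huv.symm).IsPath := hq.concat hu huv.symm
    have hs := anc_mem hT h hc
    have hsu : u = s := by
      rw [Walk.support_concat] at hs
      simp only [List.concat_eq_append, List.mem_append, List.mem_singleton] at hs
      rcases hs with hs | hs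
      · exact absurd ⟨q, hq, hs⟩ h'
      · exact hs.symm
    subst hsu
    refine ⟨rfl, _, hc, ?_⟩
    rw [Walk.support_concat]
    simp

theorem claw_nonempty {A : Set V} (h : IsClawSet T A) : A.Nonempty := by
  obtain ⟨f⟩ := h
  exact ⟨_, (f.symm (Sum.inl 0)).2⟩

theorem min_anti {x y : V} (hx : x ∈ clawMinimalSet T r) (hy : y ∈ clawMinimalSet T r)
    (h : IsAncestor T r x y) : x = y := by
  by_contra hne
  exact hx.2 y h (Ne.symm hne) hy.1

theorem walk_in (hT : T.IsTree) {s u v : V} (hu : IsAncestor T r s u)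
    (hv : IsAncestor T r s v) :
    ∃ p : T.Walk u v, p.IsPath ∧ ∀ y ∈ p.support, IsAncestor T r s y := by
  classical
  obtain ⟨p, hp⟩ := anc_down hu
  obtain ⟨q, hq⟩ := anc_down hv
  refine ⟨(p.reverse.append q).bypass, Walk.bypass_isPath _, fun y hy => ?_⟩
  have := Walk.support_bypass_subset_support _ hy
  rw [Walk.mem_support_append_iff] at this
  rcases this with h | h
  · exact hp y (by simpa using h)
  · exact hq y h

theorem walk_out (hT : T.IsTree) {s u v : V} (hu : ¬ IsAncestor T r s u)
    (hv : ¬ IsAncestor T r s v) :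
    ∃ p : T.Walk u v, p.IsPath ∧ ∀ y ∈ p.support, ¬ IsAncestor T r s y := by
  classical
  obtain ⟨p, hp⟩ := ex_path (r := r) hT u
  obtain ⟨q, hq⟩ := ex_path (r := r) hT v
  refine ⟨(p.reverse.append q).bypass, Walk.bypass_isPath _, fun y hy hs => ?_⟩
  have := Walk.support_bypass_subset_support _ hy
  rw [Walk.mem_support_append_iff] at this
  rcases this with h | h
  · exact hu (anc_trans hT hs ⟨p, hp, by simpa using h⟩)
  · exact hv (anc_trans hT hs ⟨q, hq, h⟩)

theorem config_of (hT : T.IsTree) {s a b c e : V}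
    (ha : a ∈ clawMinimalSet T r) (hb : b ∈ clawMinimalSet T r)
    (hc : c ∈ clawMinimalSet T r) (he : e ∈ clawMinimalSet T r)
    (hab : a ≠ b) (hce : c ≠ e) (hsa : IsAncestor T r s a) (hsb : IsAncestor T r s b)
    (hsc : ¬ IsAncestor T r s c) (hse : ¬ IsAncestor T r s e) :
    ∃ A B C D : Set V, NdsConfig T A B C D := by
  obtain ⟨A, hA, hA'⟩ := ha.1
  obtain ⟨B, hB, hB'⟩ := hb.1
  obtain ⟨C, hC, hC'⟩ := hc.1
  obtain ⟨D, hD, hD'⟩ := he.1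
  have sA : ∀ x ∈ A ∪ B, IsAncestor T r s x ∧ x ≠ s := by
    rintro x (hx | hx)
    · refine ⟨anc_trans hT hsa (hA hx), ?_⟩
      rintro rfl
      exact hab (min_anti ha hb (anc_trans hT (hA hx) hsb))
    · refine ⟨anc_trans hT hsb (hB hx), ?_⟩
      rintro rfl
      exact hab (min_anti hb ha (anc_trans hT (hB hx) hsa)).symm
  have key : ∀ f ∈ clawMinimalSet T r, ¬ IsAncestor T r s f → ¬ IsAncestor T r f s := by
    intro f hf h1 h2
    have := min_anti hf ha (anc_trans hT h2 hsa)
    subst this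
    exact h1 hsa
  have sC' : ∀ f ∈ clawMinimalSet T r, ¬ IsAncestor T r s f → ∀ x, IsAncestor T r f x →
      ¬ IsAncestor T r s x ∧ ¬ IsAncestor T r x s := by
    intro f hf h1 x hx
    refine ⟨fun h => ?_, fun h => key f hf h1 (anc_trans hT hx h)⟩
    rcases anc_comp h hx hT with h2 | h2
    · exact h1 h2
    · exact key f hf h1 h2
  have sC : ∀ x ∈ C ∪ D, ¬ IsAncestor T r s x ∧ ¬ IsAncestor T r x s := by
    rintro x (hx | hx)
    · exact sC' c hc hsc x (hC hx)
    · exact sC' e he hse x (hD hx)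
  have dj : ∀ {f g : V} {F G : Set V}, f ∈ clawMinimalSet T r → g ∈ clawMinimalSet T r →
      f ≠ g → F ⊆ rootedSubtree T r f → G ⊆ rootedSubtree T r g → Disjoint F G := by
    intro f g F G hf hg hfg hF hG
    rw [Set.disjoint_left]
    intro x h1 h2
    rcases anc_comp (hF h1) (hG h2) hT with h | h
    · exact hfg (min_anti hf hg h)
    · exact hfg (min_anti hg hf h).symm
  have ne : ∀ {f g : V}, IsAncestor T r s f → ¬ IsAncestor T r s g → f ≠ g := by
    rintro f g h1 h2 rfl
    exact h2 h1
  have noedge : ∀ x y, IsAncestor T r s x → y ∈ C ∪ D → ¬ T.Adj x y := by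
    intro x y hx hy hadj
    exact (sC y hy).2 (anc_edge hT hadj hx (sC y hy).1).2
  obtain ⟨a0, ha0⟩ := claw_nonempty hA'
  obtain ⟨b0, hb0⟩ := claw_nonempty hB'
  obtain ⟨c0, hc0⟩ := claw_nonempty hC'
  obtain ⟨d0, hd0⟩ := claw_nonempty hD'
  obtain ⟨P, hP, hP'⟩ := walk_in hT (sA a0 (Or.inl ha0)).1 (sA b0 (Or.inr hb0)).1
  obtain ⟨Q, hQ, hQ'⟩ := walk_out hT (sC c0 (Or.inl hc0)).1 (sC d0 (Or.inr hd0)).1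
  refine ⟨A, B, C, D, ⟨hA', hB', hC', hD', dj ha hb hab hA hB, dj ha hc (ne hsa hsc) hA hC,
    dj ha he (ne hsa hse) hA hD, dj hb hc (ne hsb hsc) hB hC, dj hb he (ne hsb hse) hB hD,
    dj hc he hce hC hD, ⟨a0, ha0, b0, hb0, P, hP, ?_⟩, ⟨c0, hc0, d0, hd0, Q, hQ, ?_⟩, ?_⟩, ?_⟩
  · rintro x hx (h | ⟨k, hk, hadj⟩)
    · exact (sC x h).1 (hP' x hx)
    · exact noedge x k (hP' x hx) hk hadj.symm
  · rintro x hx (h | ⟨k, hk, hadj⟩)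
    · exact hQ' x hx (sA x h).1
    · exact (sA k hk).2 (anc_edge hT hadj (sA k hk).1 (hQ' x hx)).1
  · intro x hx y hy hadj
    exact absurd hadj (noedge x y (sA x hx).1 hy)
  · intro x hx y hy hadj
    exact absurd hadj (noedge x y (sA x hx).1 hy)

theorem lca_outside (hT : T.IsTree) {X : Set V} {s z : V} (hz : z ∈ lcaSet T r X)
    (hzs : IsAncestor T r z s) (hne : z ≠ s) :
    ∃ c ∈ X, IsAncestor T r z c ∧ ¬ IsAncestor T r s c := by
  obtain ⟨x, hx, y, hy, -, h1, h2, h3⟩ := hz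
  by_cases h : IsAncestor T r s x
  · refine ⟨y, hy, h2, fun h' => hne (anc_antisymm hT hzs (h3 s h h'))⟩
  · exact ⟨x, hx, h1, h⟩

theorem no_chain (hT : T.IsTree) (hb : ¬ ∃ A B C D : Set V, NdsConfig T A B C D) {z₁ z₂ z₃ : V}
    (h1 : z₁ ∈ lcaSet T r (clawMinimalSet T r)) (h2 : z₂ ∈ lcaSet T r (clawMinimalSet T r))
    (h3 : z₃ ∈ lcaSet T r (clawMinimalSet T r)) (h12 : IsAncestor T r z₁ z₂)
    (h23 : IsAncestor T r z₂ z₃) (n12 : z₁ ≠ z₂) (n23 : z₂ ≠ z₃) : False := by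
  obtain ⟨c, hc, hc1, hc2⟩ := lca_outside hT h2 h23 n23
  obtain ⟨e, he, he1, he2⟩ := lca_outside hT h1 h12 n12
  obtain ⟨x, hx, y, hy, hxy, hl1, hl2, -⟩ := h3
  refine hb (config_of hT hx hy hc he hxy ?_ hl1 hl2 hc2 fun h => he2 (anc_trans hT h23 h))
  rintro rfl
  exact he2 hc1

theorem lca_comp (hT : T.IsTree) (hb : ¬ ∃ A B C D : Set V, NdsConfig T A B C D) {z₁ z₂ : V}
    (h1 : z₁ ∈ lcaSet T r (clawMinimalSet T r)) (h2 : z₂ ∈ lcaSet T r (clawMinimalSet T r)) :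
    IsAncestor T r z₁ z₂ ∨ IsAncestor T r z₂ z₁ := by
  by_contra hcon
  obtain ⟨x, hx, y, hy, hxy, hl1, hl2, -⟩ := h1
  obtain ⟨c, hc, d, hd, hcd, hm1, hm2, -⟩ := h2
  exact hb (config_of hT hx hy hc hd hxy hcd hl1 hl2 (fun h => hcon (anc_comp h hm1 hT))
    (fun h => hcon (anc_comp h hm2 hT)))

end Helpers

theorem statement9 (V : Type) [Fintype V] (T : SimpleGraph V) (hT : T.IsTree) (r : V)
    (hb : ¬ ∃ A B C D : Set V, NdsConfig T A B C D) :
    (lcaSet T r (clawMinimalSet T r)).ncard ≤ 2 ∧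
      ∀ z₁ ∈ lcaSet T r (clawMinimalSet T r), ∀ z₂ ∈ lcaSet T r (clawMinimalSet T r),
        IsAncestor T r z₁ z₂ ∨ IsAncestor T r z₂ z₁ := by
  refine ⟨?_, fun z₁ h₁ z₂ h₂ => lca_comp hT hb h₁ h₂⟩
  by_contra hcard
  push Not at hcard
  obtain ⟨x, y, z, hx, hy, hz, hxy, hxz, hyz⟩ := (Set.two_lt_ncard_iff (Set.toFinite _)).1 hcard
  have cxy := lca_comp hT hb hx hy
  have cxz := lca_comp hT hb hx hz
  have cyz := lca_comp hT hb hy hz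
  rcases cxy with h | h <;> rcases cxz with h' | h' <;> rcases cyz with h'' | h''
  · exact no_chain hT hb hx hy hz h h'' hxy hyz
  · exact no_chain hT hb hx hz hy h' h'' hxz hyz.symm
  · exact no_chain hT hb hz hx hy h' h hxz.symm hxy
  · exact no_chain hT hb hz hx hy h' h hxz.symm hxy
  · exact no_chain hT hb hy hx hz h h' hxy.symm hxz
  · exact no_chain hT hb hy hx hz h h' hxy.symm hxz
  · exact no_chain hT hb hy hz hx h'' h' hyz hxz.symm
  · exact no_chain hT hb hz hy hx h'' h hyz.symm hxy.symm

end Paper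
end

section
/- Let ℓ be a positive integer, let C = (S_C, L_C) be an (ℓ+1)-ample constellation (in the strengthened sense), let M be an induced minor model of some graph H in C such that there is a path P ∈ L_C whose vertex set is disjoint from every branch set of M, and let z ∈ S_C belong to the branch set of M representing a vertex u of H. Then there is an induced minor model M' ⊇ M in C of the graph H' obtained from H by adding a disjoint path on 2ℓ+1 vertices and making u adjacent to the center of this path, and moreover the union of the branch sets of M' is contained in the union of the branch sets of M together with V(P). -/
open SimpleGraph

namespace Paper

variable {V W : Type*}

theorem walk_aux {V : Type*} (G : SimpleGraph V) (f : ℕ → V) (i : ℕ) : ∀ d : ℕ,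
    (∀ m, i ≤ m → m < i + d → G.Adj (f m) (f (m + 1))) →
    (∀ m m', i ≤ m → m ≤ i + d → i ≤ m' → m' ≤ i + d → f m = f m' → m = m') →
    ∃ p : G.Walk (f i) (f (i + d)), p.IsPath ∧ p.length = d ∧
      ∀ x ∈ p.support, ∃ m, i ≤ m ∧ m ≤ i + d ∧ x = f m := by
  intro d
  induction d with
  | zero =>
    intro _ _
    refine ⟨Walk.nil, Walk.IsPath.nil, rfl, ?_⟩
    intro x hx
    exact ⟨i, le_rfl, le_rfl, by simpa using hx⟩
  | succ d ih =>
    intro hadj hinj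
    obtain ⟨p, hp, hl, hs⟩ := ih (fun m h1 h2 => hadj m h1 (by omega))
      (fun m m' h1 h2 h3 h4 h => hinj m m' h1 (by omega) h3 (by omega) h)
    have ha : G.Adj (f (i + d)) (f (i + (d + 1))) := hadj (i + d) (by omega) (by omega)
    refine ⟨p.concat ha, ?_, by simp [hl], ?_⟩
    · refine hp.concat ?_ ha
      intro hx
      obtain ⟨m, h1, h2, h3⟩ := hs _ hx
      have := hinj _ m (by omega) le_rfl h1 (by omega) h3
      omega
    · intro x hx
      rw [Walk.support_concat] at hx
      simp only [List.concat_eq_append, List.mem_append, List.mem_singleton] at hx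
      rcases hx with hx | hx
      · obtain ⟨m, h1, h2, h3⟩ := hs _ hx
        exact ⟨m, h1, by omega, h3⟩
      · exact ⟨i + (d + 1), by omega, le_rfl, hx⟩

theorem interval_connected {V : Type*} (G : SimpleGraph V) (f : ℕ → V) (lo hi : ℕ)
    (h : lo ≤ hi) (hadj : ∀ m, lo ≤ m → m < hi → G.Adj (f m) (f (m + 1)))
    (hinj : ∀ m m', lo ≤ m → m ≤ hi → lo ≤ m' → m' ≤ hi → f m = f m' → m = m') :
    (G.induce {x | ∃ m, lo ≤ m ∧ m ≤ hi ∧ x = f m}).Connected := by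
  rw [connected_iff_exists_forall_reachable]
  refine ⟨⟨f lo, lo, le_rfl, h, rfl⟩, ?_⟩
  rintro ⟨x, m, h1, h2, rfl⟩
  obtain ⟨d, rfl⟩ := Nat.exists_eq_add_of_le h1
  obtain ⟨p, -, -, hs⟩ := walk_aux G f lo d (fun m h1 h2 => hadj m h1 (by omega))
      (fun m m' h1 h2 h3 h4 h => hinj m m' h1 (by omega) h3 (by omega) h)
  refine ⟨p.induce _ ?_⟩
  intro x hx
  obtain ⟨m, h1, h2, h3⟩ := hs x hx
  exact ⟨m, h1, by omega, h3⟩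

theorem statement11 (ℓ : ℕ) (hℓ : 1 ≤ ℓ) (V : Type) (G : SimpleGraph V)
    (SC : Set V) (LC : Set (Set V)) (hC : IsConstellation G SC LC)
    (hA : IsAmpleStrong G SC LC (ℓ + 1))
    (VH : Type) (H : SimpleGraph VH) (M : VH → Set V)
    (hM : IsInducedMinorModel H G M)
    (P : Set V) (hP : P ∈ LC) (hPM : ∀ v : VH, Disjoint (M v) P)
    (z : V) (hz : z ∈ SC) (u : VH) (hu : z ∈ M u) :
    ∃ M' : VH ⊕ Fin (2 * ℓ + 1) → Set V,
      IsInducedMinorModel (addPendantPath H u ℓ) G M' ∧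
      (∀ v : VH, M' (Sum.inl v) = M v) ∧
      (⋃ x, M' x) ⊆ (⋃ v, M v) ∪ P := by
  classical
  obtain ⟨n, ⟨e⟩⟩ := hC.pathsArePaths P hP
  obtain ⟨f, hf⟩ : ∃ f : ℕ → V, ∀ j (h : j < n), f j = (e.symm ⟨j, h⟩ : P).1 :=
    ⟨fun j => if h : j < n then (e.symm ⟨j, h⟩ : P).1 else z, fun j h => by simp [h]⟩
  have fP : ∀ j, j < n → f j ∈ P := fun j h => by rw [hf j h]; exact (e.symm ⟨j, h⟩).2
  have fsurj : ∀ v ∈ P, ∃ j, j < n ∧ v = f j := by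
    intro v hv
    refine ⟨(e ⟨v, hv⟩).1, (e ⟨v, hv⟩).2, ?_⟩
    rw [hf _ (e ⟨v, hv⟩).2]
    simp
  have finj : ∀ i j, i < n → j < n → f i = f j → i = j := by
    intro i j hi hj h
    rw [hf i hi, hf j hj] at h
    have := e.symm.injective (Subtype.ext h)
    simpa using this
  have fadj : ∀ i j, i < n → j < n → (G.Adj (f i) (f j) ↔ (i + 1 = j ∨ j + 1 = i)) := by
    intro i j hi hj
    have h1 : (G.induce P).Adj (e.symm ⟨i, hi⟩) (e.symm ⟨j, hj⟩) ↔ _ := e.symm.map_adj_iff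
    rw [pathGraph_adj] at h1
    rw [hf i hi, hf j hj]
    simpa using h1
  -- distance bound
  have hdist : ∀ i d (h : i + d < n), (G.induce P).dist ⟨f i, fP i (by omega)⟩
      ⟨f (i + d), fP _ h⟩ ≤ d := by
    intro i d h
    have key : ∀ m (hm : m < n), (⟨f m, fP m hm⟩ : P) = e.symm ⟨m, hm⟩ :=
      fun m hm => Subtype.ext (hf m hm)
    let g : ℕ → P := fun m => if hm : m < n then ⟨f m, fP m hm⟩ else ⟨f i, fP i (by omega)⟩
    have hg : ∀ m (hm : m < n), g m = ⟨f m, fP m hm⟩ := fun m hm => by simp [g, hm]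
    obtain ⟨p, -, hl, -⟩ := walk_aux (G.induce P) g i d
      (by
        intro m h1 h2
        rw [hg m (by omega), hg (m + 1) (by omega)]
        exact (fadj m (m + 1) (by omega) (by omega)).2 (Or.inl rfl))
      (by
        intro m m' h1 h2 h3 h4 h5
        rw [hg m (by omega), hg m' (by omega)] at h5
        exact finj m m' (by omega) (by omega) (congrArg Subtype.val h5))
    have h6 := dist_le p
    rw [hl, hg i (by omega), hg (i + d) h] at h6
    exact h6
  have hend : ∀ s ∈ SC, ∀ j, j < n → G.Adj s (f j) → ℓ + 1 ≤ j ∧ j + ℓ + 1 < n := by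
    intro s hs j hj hsj
    constructor
    · have h0 : IsPathEndpoint G P (f 0) := by
        refine ⟨fP 0 (by omega), ?_⟩
        refine (Set.ncard_le_ncard (t := {f 1}) ?_ (Set.finite_singleton _)).trans
          (Set.ncard_singleton _).le
        rintro v ⟨hv, hav⟩
        obtain ⟨m, hm, rfl⟩ := fsurj v hv
        rcases (fadj 0 m (by omega) hm).1 hav with h | h
        · simp [← h]
        · omega
      have h1 := hA.2 s hs P hP (f j) (fP j hj) hsj (f 0) (fP 0 (by omega)) h0
      rw [dist_comm] at h1
      have h2 := hdist 0 j (by omega)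
      simp only [Nat.zero_add] at h2
      omega
    · have h0 : IsPathEndpoint G P (f (n - 1)) := by
        refine ⟨fP _ (by omega), ?_⟩
        refine (Set.ncard_le_ncard (t := {f (n - 2)}) ?_ (Set.finite_singleton _)).trans
          (Set.ncard_singleton _).le
        rintro v ⟨hv, hav⟩
        obtain ⟨m, hm, rfl⟩ := fsurj v hv
        rcases (fadj (n - 1) m (by omega) hm).1 hav with h | h
        · omega
        · have : m = n - 2 := by omega
          simp [this]
      have h1 := hA.2 s hs P hP (f j) (fP j hj) hsj (f (n - 1)) (fP _ (by omega)) h0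
      obtain ⟨d, hd⟩ : ∃ d, n - 1 = j + d := ⟨n - 1 - j, by omega⟩
      have h2 := hdist j d (by omega)
      simp only [hd] at h1
      omega
  have hPS : ∀ x, x ∈ P → x ∉ SC := fun x hx hx' =>
    Set.disjoint_left.1 (hC.pathsOffS P hP) hx hx'
  have hroute : ∀ s ∈ SC, ∀ t ∈ SC, s ≠ t → ∀ i d, i + d < n → G.Adj s (f i) →
      G.Adj t (f (i + d)) → ℓ < d := by
    intro s hs t ht hst i d hd hsi htj
    obtain ⟨p, hp, hl, hsup⟩ := walk_aux G f i d
      (fun m h1 h2 => (fadj m (m + 1) (by omega) (by omega)).2 (Or.inl rfl))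
      (fun m m' h1 h2 h3 h4 h5 => finj m m' (by omega) (by omega) h5)
    have hsupP : ∀ x ∈ p.support, x ∈ P := by
      intro x hx
      obtain ⟨m, h1, h2, rfl⟩ := hsup x hx
      exact fP m (by omega)
    have hq : (p.concat htj.symm).IsPath :=
      hp.concat (fun h => hPS _ (hsupP _ h) ht) htj.symm
    have hmem : ∀ x, x ∈ (p.concat htj.symm).support → x ∈ P ∨ x = t := by
      intro x hx
      rw [Walk.support_concat] at hx
      simp only [List.concat_eq_append, List.mem_append, List.mem_singleton] at hx
      exact hx.imp (hsupP x) id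
    have hr : IsRoute G SC s t (Walk.cons hsi (p.concat htj.symm)) := by
      refine ⟨hs, ht, ?_, by simp, ?_⟩
      · rw [Walk.cons_isPath_iff]
        refine ⟨hq, fun h => ?_⟩
        rcases hmem _ h with h | h
        · exact hPS _ h hs
        · exact hst h
      · intro v hv h1 h2
        rw [Walk.support_cons, List.mem_cons] at hv
        rcases hv with hv | hv
        · exact absurd hv h1
        · rcases hmem _ hv with h | h
          · exact hPS _ h
          · exact absurd h h2
    have := hA.1 s t _ hr
    simp [hl] at this
    omega
  -- initial neighbour
  obtain ⟨v0, hv0, hzv0⟩ := hC.dominates z hz P hP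
  obtain ⟨k, hk, rfl⟩ := fsurj v0 hv0
  have honly : ∀ i d, i + d < n → d ≤ ℓ → ∀ s ∈ SC, (G.Adj z (f i) ∧ G.Adj s (f (i + d))) ∨
      (G.Adj s (f i) ∧ G.Adj z (f (i + d))) → s = z := by
    intro i d hid hd s hs h
    by_contra hne
    rcases h with ⟨h1, h2⟩ | ⟨h1, h2⟩
    · have := hroute z hz s hs (Ne.symm hne) i d hid h1 h2
      omega
    · have := hroute s hs z hz hne i d hid h1 h2
      omega
  -- left end
  have hQa : ∃ a, a ≤ k ∧ G.Adj z (f a) ∧ ∀ m, a ≤ m → m ≤ k → ∀ s ∈ SC, G.Adj s (f m) → s = z := by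
    refine ⟨k, le_rfl, hzv0, fun m h1 h2 s hs h => ?_⟩
    obtain rfl : m = k := by omega
    exact honly m 0 (by omega) (by omega) s hs (Or.inl ⟨hzv0, h⟩)
  obtain ⟨a, ⟨hak, hza, hall⟩, hamin⟩ : ∃ a, (a ≤ k ∧ G.Adj z (f a) ∧
      ∀ m, a ≤ m → m ≤ k → ∀ s ∈ SC, G.Adj s (f m) → s = z) ∧ ∀ a' < a, ¬ (a' ≤ k ∧ G.Adj z (f a') ∧
      ∀ m, a' ≤ m → m ≤ k → ∀ s ∈ SC, G.Adj s (f m) → s = z) :=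
    ⟨Nat.find hQa, Nat.find_spec hQa, fun a' h => Nat.find_min hQa h⟩
  -- right end, as n - c
  have hQb : ∃ c, ∃ b, b + c + 1 = n ∧ k ≤ b ∧ G.Adj z (f b) ∧
      ∀ m, k ≤ m → m ≤ b → ∀ s ∈ SC, G.Adj s (f m) → s = z := by
    refine ⟨n - 1 - k, k, by omega, le_rfl, hzv0, fun m h1 h2 s hs h => ?_⟩
    obtain rfl : m = k := by omega
    exact honly m 0 (by omega) (by omega) s hs (Or.inl ⟨hzv0, h⟩)
  obtain ⟨b, hbn, hkb, hzb, hbll, hbmax⟩ : ∃ b, b < n ∧ k ≤ b ∧ G.Adj z (f b) ∧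
      (∀ m, k ≤ m → m ≤ b → ∀ s ∈ SC, G.Adj s (f m) → s = z) ∧ ∀ b', b < b' → b' < n →
      ¬ (G.Adj z (f b') ∧ ∀ m, k ≤ m → m ≤ b' → ∀ s ∈ SC, G.Adj s (f m) → s = z) := by
    obtain ⟨b, h1, h2, h3, h4⟩ := Nat.find_spec hQb
    refine ⟨b, by omega, h2, h3, h4, ?_⟩
    rintro b' hb hb' ⟨h5, h6⟩
    exact Nat.find_min hQb (m := n - 1 - b') (by omega) ⟨b', by omega, by omega, h5, h6⟩
  have hmid : ∀ m, a ≤ m → m ≤ b → ∀ s ∈ SC, G.Adj s (f m) → s = z := by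
    intro m h1 h2
    rcases le_total m k with h | h
    · exact hall m h1 h
    · exact hbll m h h2
  obtain ⟨haL, -⟩ := hend z hz a (by omega) hza
  obtain ⟨-, hbR⟩ := hend z hz b hbn hzb
  have hleft : ∀ m, m < a → a ≤ m + ℓ → ∀ s ∈ SC, ¬ G.Adj s (f m) := by
    intro m h1 h2 s hs h
    have hone : ∀ m', m' < a → a ≤ m' + ℓ → ∀ s ∈ SC, G.Adj s (f m') → s = z := by
      intro m' h1 h2 s hs h
      obtain ⟨d, rfl⟩ := Nat.exists_eq_add_of_le h1.le
      exact honly m' d (by omega) (by omega) s hs (Or.inr ⟨h, hza⟩)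
    obtain rfl := hone m h1 h2 s hs h
    refine hamin m h1 ⟨by omega, h, fun m' h3 h4 t ht h5 => ?_⟩
    rcases lt_or_ge m' a with h6 | h6
    · exact hone m' h6 (by omega) t ht h5
    · exact hall m' h6 h4 t ht h5
  have hright : ∀ m, b < m → m ≤ b + ℓ → ∀ s ∈ SC, ¬ G.Adj s (f m) := by
    intro m h1 h2 s hs h
    have hone : ∀ m', b < m' → m' ≤ b + ℓ → ∀ s ∈ SC, G.Adj s (f m') → s = z := by
      intro m' h1 h2 s hs h
      obtain ⟨d, rfl⟩ := Nat.exists_eq_add_of_le h1.le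
      exact honly b d (by omega) (by omega) s hs (Or.inl ⟨hzb, h⟩)
    obtain rfl := hone m h1 h2 s hs h
    refine hbmax m h1 (by omega) ⟨h, fun m' h3 h4 t ht h5 => ?_⟩
    rcases lt_or_ge b m' with h6 | h6
    · exact hone m' h6 (by omega) t ht h5
    · exact hbll m' h3 h6 t ht h5
  -- the new branch sets
  obtain ⟨lo, hlo⟩ : ∃ lo : ℕ → ℕ, ∀ i, (i ≤ ℓ → lo i = a + i - ℓ) ∧ (ℓ < i → lo i = b + i - ℓ) :=
    ⟨fun i => if i ≤ ℓ then a + i - ℓ else b + i - ℓ, fun i =>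
      ⟨fun h => by simp [h], fun h => by simp [Nat.not_le.2 h]⟩⟩
  obtain ⟨hi, hhi⟩ : ∃ hi : ℕ → ℕ, ∀ i, (i < ℓ → hi i = a + i - ℓ) ∧ (ℓ ≤ i → hi i = b + i - ℓ) :=
    ⟨fun i => if i < ℓ then a + i - ℓ else b + i - ℓ, fun i =>
      ⟨fun h => by simp [h], fun h => by simp [Nat.not_lt.2 h]⟩⟩
  have hlohi : ∀ i, i < 2 * ℓ + 1 → lo i ≤ hi i ∧ hi i < n := by
    intro i h
    have := hlo i; have := hhi i
    omega
  obtain ⟨B, hB⟩ : ∃ B : ℕ → Set V, ∀ i, B i = {x | ∃ m, lo i ≤ m ∧ m ≤ hi i ∧ x = f m} :=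
    ⟨_, fun i => rfl⟩
  have hBP : ∀ i, i < 2 * ℓ + 1 → B i ⊆ P := by
    intro i h x hx
    rw [hB] at hx
    obtain ⟨m, h1, h2, rfl⟩ := hx
    have := hlohi i h
    exact fP m (by omega)
  have hBdisj : ∀ i j, i < 2 * ℓ + 1 → j < 2 * ℓ + 1 → i ≠ j → Disjoint (B i) (B j) := by
    intro i j h h' hij
    rw [Set.disjoint_left]
    intro x hx hx'
    rw [hB] at hx hx'
    obtain ⟨m, h1, h2, rfl⟩ := hx
    obtain ⟨m', h3, h4, h5⟩ := hx'
    have := hlohi i h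
    have := hlohi j h'
    have := finj m m' (by omega) (by omega) h5
    have := hlo i; have := hhi i; have := hlo j; have := hhi j
    omega
  have hBadj : ∀ i j, i < 2 * ℓ + 1 → j < 2 * ℓ + 1 → i ≠ j →
      ((∃ x ∈ B i, ∃ y ∈ B j, G.Adj x y) ↔ (i + 1 = j ∨ j + 1 = i)) := by
    intro i j h h' hij
    have e1 := hlohi i h
    have e2 := hlohi j h'
    have e3 := hlo i
    have e4 := hhi i
    have e5 := hlo j
    have e6 := hhi j
    constructor
    · rintro ⟨x, hx, y, hy, hxy⟩
      rw [hB] at hx hy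
      obtain ⟨m, h1, h2, rfl⟩ := hx
      obtain ⟨m', h3, h4, rfl⟩ := hy
      have := (fadj m m' (by omega) (by omega)).1 hxy
      omega
    · rintro (hh | hh)
      · refine ⟨f (hi i), ?_, f (lo j), ?_, ?_⟩
        · rw [hB]; exact ⟨_, e1.1, le_rfl, rfl⟩
        · rw [hB]; exact ⟨_, le_rfl, e2.1, rfl⟩
        · rw [fadj _ _ (by omega) (by omega)]; omega
      · refine ⟨f (lo i), ?_, f (hi j), ?_, ?_⟩
        · rw [hB]; exact ⟨_, le_rfl, e1.1, rfl⟩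
        · rw [hB]; exact ⟨_, e2.1, le_rfl, rfl⟩
        · rw [fadj _ _ (by omega) (by omega)]; omega
  have hMB : ∀ v i, i < 2 * ℓ + 1 → ((∃ x ∈ M v, ∃ y ∈ B i, G.Adj x y) ↔ (v = u ∧ i = ℓ)) := by
    intro v i h
    have e1 := hlohi i h
    have e3 := hlo i
    have e4 := hhi i
    constructor
    · rintro ⟨x, hx, y, hy, hxy⟩
      have hyP := hBP i h hy
      rw [hB] at hy
      obtain ⟨m, h1, h2, rfl⟩ := hy
      have hxP : x ∉ P := fun hh => Set.disjoint_left.1 (hPM v) hx hh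
      have hxS : x ∈ SC := by
        by_contra hxS
        obtain ⟨Q, hQ, hxQ⟩ := hC.cover x hxS
        have hne : Q ≠ P := by rintro rfl; exact hxP hxQ
        exact hC.pathsSep Q hQ P hP hne x hxQ _ hyP hxy
      have hil : i = ℓ := by
        by_contra hil
        rcases lt_or_gt_of_ne hil with h5 | h5
        · exact hleft m (by omega) (by omega) x hxS hxy
        · exact hright m (by omega) (by omega) x hxS hxy
      have hxz := hmid m (by omega) (by omega) x hxS hxy
      refine ⟨?_, hil⟩
      by_contra hvu
      subst hxz
      exact Set.disjoint_left.1 (hM.2.2.1 hvu) hx hu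
    · rintro ⟨rfl, rfl⟩
      refine ⟨z, hu, f a, ?_, hza⟩
      rw [hB]
      exact ⟨a, by omega, by omega, rfl⟩
  refine ⟨Sum.elim M (fun i => B i), ⟨?_, ?_, ?_, ?_⟩, fun v => rfl, ?_⟩
  · rintro (v | i)
    · exact hM.1 v
    · have := hlohi i i.2
      refine ⟨f (lo i), ?_⟩
      simp only [Sum.elim_inr, hB]
      exact ⟨_, le_rfl, this.1, rfl⟩
  · rintro (v | i)
    · exact hM.2.1 v
    · have := hlohi i i.2
      simp only [Sum.elim_inr]
      rw [hB]
      exact interval_connected G f _ _ this.1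
        (fun m h1 h2 => (fadj m (m + 1) (by omega) (by omega)).2 (Or.inl rfl))
        (fun m m' h1 h2 h3 h4 h5 => finj m m' (by omega) (by omega) h5)
  · rintro (v | i) (w | j) hne
    · exact hM.2.2.1 (fun h => hne (by rw [h]))
    · exact (hPM v).mono_right (hBP j j.2)
    · exact ((hPM w).mono_right (hBP i i.2)).symm
    · exact hBdisj i j i.2 j.2 (fun h => hne (by rw [Fin.ext h]))
  · rintro (v | i) (w | j) hne
    · have h := hM.2.2.2 v w (fun h => hne (by rw [h]))
      simp only [Sum.elim_inl, addPendantPath, fromRel_adj]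
      rw [h]
      exact ⟨fun h => ⟨hne, Or.inl h⟩, fun h => h.2.elim id (fun h => h.symm)⟩
    · simp only [Sum.elim_inl, Sum.elim_inr, addPendantPath, fromRel_adj]
      rw [hMB v j j.2]
      simp
    · simp only [Sum.elim_inl, Sum.elim_inr, addPendantPath, fromRel_adj]
      have h := hMB w i i.2
      constructor
      · rintro ⟨x, hx, y, hy, hxy⟩
        exact ⟨hne, Or.inr (h.1 ⟨y, hy, x, hx, hxy.symm⟩)⟩
      · rintro ⟨-, h1 | h1⟩
        · exact h1.elim
        · obtain ⟨x, hx, y, hy, hxy⟩ := h.2 h1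
          exact ⟨y, hy, x, hx, hxy.symm⟩
    · simp only [Sum.elim_inr, addPendantPath, fromRel_adj]
      rw [hBadj i j i.2 j.2 (fun h => hne (by rw [Fin.ext h]))]
      exact ⟨fun h => ⟨hne, h⟩, fun h => h.2⟩
  · apply Set.iUnion_subset
    rintro (v | i)
    · exact (Set.subset_iUnion M v).trans Set.subset_union_left
    · exact (hBP i i.2).trans Set.subset_union_right

end Paper
end
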